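/- arXiv:1805.10098 — 3 statements merged into one kernel-verified Lean document; each statement's English description precedes it below -/
import Mathlib

section
/- Let (X,d) be a Cantor space. Then there exists a homeomorphism f of X such that f³ (the third iterate of f) is topologically stable, but f itself is not topologically stable. -/
/-! Common definitions: distances on maps/homeomorphisms of a metric space,
topological stability and shadowing-type properties. -/

variable {X : Type*} [MetricSpace X]

/-- The `C⁰`-distance `d_{C⁰}(f,g) = sup_{x ∈ X} d (f x) (g x)` between self-maps. -/
noncomputable def dC0 (f g : X → X) : ℝ :=
  ⨆ x : X, dist (f x) (g x)

/-- The distance `D(f,g) = max (d_{C⁰}(f,g)) (d_{C⁰}(f⁻¹,g⁻¹))` between homeomorphisms. -/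
noncomputable def DH (f g : X ≃ₜ X) : ℝ :=
  max (dC0 (f : X → X) (g : X → X)) (dC0 (f.symm : X → X) (g.symm : X → X))

/-- `f` is topologically stable. -/
def TopologicallyStable (f : X ≃ₜ X) : Prop :=
  ∀ ε > 0, ∃ δ > 0, ∀ g : X ≃ₜ X, DH f g < δ →
    ∃ h : X → X, Continuous h ∧ dC0 h id < ε ∧ h ∘ (g : X → X) = (f : X → X) ∘ h

/-- `f` is topologically stable in the strong sense (the conjugating map is surjective). -/
def STopologicallyStable (f : X ≃ₜ X) : Prop :=
  ∀ ε > 0, ∃ δ > 0, ∀ g : X ≃ₜ X, DH f g < δ →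
    ∃ h : X → X, Continuous h ∧ Function.Surjective h ∧ dC0 h id < ε ∧
      h ∘ (g : X → X) = (f : X → X) ∘ h

/-- `f` has the shadowing property. -/
def HasShadowing (f : X ≃ₜ X) : Prop :=
  ∀ ε > 0, ∃ δ > 0, ∀ x : ℕ → X,
    (∀ i, dist (f (x i)) (x (i + 1)) ≤ δ) →
    ∃ p : X, ∀ i, dist (x i) ((f : X → X)^[i] p) ≤ ε

/-- `f` has the strict periodic shadowing property: every `δ`-cycle of length `m`
is `ε`-shadowed by a point `p` with `f^[m] p = p`. -/
def StrictPeriodicShadowing (f : X ≃ₜ X) : Prop :=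
  ∀ ε > 0, ∃ δ > 0, ∀ (m : ℕ) (x : ℕ → X), 1 ≤ m →
    (∀ i < m, dist (f (x i)) (x (i + 1)) ≤ δ) → x 0 = x m →
    ∃ p : X, (f : X → X)^[m] p = p ∧ ∀ i ≤ m, dist (x i) ((f : X → X)^[i] p) ≤ ε

/-- `f` has the periodic shadowing property: every `δ`-cycle is `ε`-shadowed by
a periodic point of `f`. -/
def PeriodicShadowing (f : X ≃ₜ X) : Prop :=
  ∀ ε > 0, ∃ δ > 0, ∀ (m : ℕ) (x : ℕ → X), 1 ≤ m →
    (∀ i < m, dist (f (x i)) (x (i + 1)) ≤ δ) → x 0 = x m →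
    ∃ p ∈ Function.periodicPts (f : X → X), ∀ i ≤ m, dist (x i) ((f : X → X)^[i] p) ≤ ε

/-- `x` is a chain recurrent point of `f`: for every `δ > 0` there is a `δ`-cycle
of `f` through `x`. -/
def ChainRecurrent (f : X → X) (x : X) : Prop :=
  ∀ δ > 0, ∃ (m : ℕ) (c : ℕ → X), 1 ≤ m ∧ c 0 = x ∧ c m = x ∧
    ∀ i < m, dist (f (c i)) (c (i + 1)) ≤ δ

/-- `f` has the pseudo periodic shadowing property: every `δ`-cycle is `ε`-shadowed
by some (not necessarily periodic) point. -/
def PseudoPeriodicShadowing (f : X → X) : Prop :=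
  ∀ ε > 0, ∃ δ > 0, ∀ (m : ℕ) (x : ℕ → X), 1 ≤ m →
    (∀ i < m, dist (f (x i)) (x (i + 1)) ≤ δ) → x 0 = x m →
    ∃ p : X, ∀ i ≤ m, dist (x i) (f^[i] p) ≤ ε

/-- The property* of a compact metric space. -/
def PropertyStar (Y : Type*) [MetricSpace Y] : Prop :=
  ∀ ε > 0, ∃ δ > 0, ∀ (n : ℕ) (x y : Fin n → Y), 1 ≤ n →
    Function.Injective x → Function.Injective y →
    (∀ i, dist (x i) (y i) < δ) →
    ∃ φ : Y ≃ₜ Y, DH φ (Homeomorph.refl Y) < ε ∧ ∀ i, φ (x i) = y i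

/-- `f` is an equicontinuous homeomorphism: the family of all iterates
`f^n`, `n ∈ ℤ`, is uniformly equicontinuous. -/
def EquicontinuousHomeo (f : X ≃ₜ X) : Prop :=
  ∀ ε > 0, ∃ δ > 0, ∀ x y : X, dist x y ≤ δ →
    ∀ n : ℤ, dist ((f.toEquiv ^ n) x) ((f.toEquiv ^ n) y) ≤ ε

/-- The set of bi-infinite `δ`-pseudo orbits of `f`. -/
def PseudoOrbitsZ (f : X ≃ₜ X) (δ : ℝ) : Set (ℤ → X) :=
  {x | ∀ i : ℤ, dist (f (x i)) (x (i + 1)) ≤ δ}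

/-- `f` has the continuous shadowing property. -/
def ContinuousShadowing (f : X ≃ₜ X) : Prop :=
  ∀ ε > 0, ∃ δ > 0, ∃ r : PseudoOrbitsZ f δ → X, Continuous r ∧
    ∀ x : PseudoOrbitsZ f δ, ∀ i : ℤ,
      dist ((f.toEquiv ^ i) (r x)) ((x : ℤ → X) i) ≤ ε

/-- `x` is a non-wandering point of `f`. -/
def NonWandering (f : X ≃ₜ X) (x : X) : Prop :=
  ∀ U ∈ nhds x, ∃ n : ℕ, 0 < n ∧ ∃ y ∈ U, (f : X → X)^[n] y ∈ U

namespace CubeStab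

/-- The alphabet: binary digits together with three special letters. -/
abbrev A : Type := Bool ⊕ Fin 3

/-- The model homeomorphism (binary odometer up to the first special letter, which is rotated). -/
noncomputable def F (x : ℕ → A) (i : ℕ) : A :=
  open Classical in
  Sum.elim
    (fun b => if (∀ j < i, x j = Sum.inl true) then Sum.inl (!b) else Sum.inl b)
    (fun s => if (∀ j < i, (x j).isLeft = true) then Sum.inr (s + 1) else Sum.inr s) (x i)

/-- The inverse of the model homeomorphism. -/
noncomputable def G (x : ℕ → A) (i : ℕ) : A :=
  open Classical in
  Sum.elim
    (fun b => if (∀ j < i, x j = Sum.inl false) then Sum.inl (!b) else Sum.inl b)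
    (fun s => if (∀ j < i, (x j).isLeft = true) then Sum.inr (s + 2) else Sum.inr s) (x i)

theorem F_inl_pos {x : ℕ → A} {i : ℕ} {b : Bool} (hi : x i = Sum.inl b)
    (h : ∀ j < i, x j = Sum.inl true) : F x i = Sum.inl (!b) := by
  unfold F
  rw [hi, Sum.elim_inl, if_pos h]

theorem F_inl_neg {x : ℕ → A} {i : ℕ} {b : Bool} (hi : x i = Sum.inl b)
    (h : ¬ ∀ j < i, x j = Sum.inl true) : F x i = Sum.inl b := by
  unfold F
  rw [hi, Sum.elim_inl, if_neg h]

theorem F_inr_pos {x : ℕ → A} {i : ℕ} {s : Fin 3} (hi : x i = Sum.inr s)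
    (h : ∀ j < i, (x j).isLeft = true) : F x i = Sum.inr (s + 1) := by
  unfold F
  rw [hi, Sum.elim_inr, if_pos h]

theorem F_inr_neg {x : ℕ → A} {i : ℕ} {s : Fin 3} (hi : x i = Sum.inr s)
    (h : ¬ ∀ j < i, (x j).isLeft = true) : F x i = Sum.inr s := by
  unfold F
  rw [hi, Sum.elim_inr, if_neg h]

theorem G_inl_pos {x : ℕ → A} {i : ℕ} {b : Bool} (hi : x i = Sum.inl b)
    (h : ∀ j < i, x j = Sum.inl false) : G x i = Sum.inl (!b) := by
  unfold G
  rw [hi, Sum.elim_inl, if_pos h]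

theorem G_inl_neg {x : ℕ → A} {i : ℕ} {b : Bool} (hi : x i = Sum.inl b)
    (h : ¬ ∀ j < i, x j = Sum.inl false) : G x i = Sum.inl b := by
  unfold G
  rw [hi, Sum.elim_inl, if_neg h]

theorem G_inr_pos {x : ℕ → A} {i : ℕ} {s : Fin 3} (hi : x i = Sum.inr s)
    (h : ∀ j < i, (x j).isLeft = true) : G x i = Sum.inr (s + 2) := by
  unfold G
  rw [hi, Sum.elim_inr, if_pos h]

theorem G_inr_neg {x : ℕ → A} {i : ℕ} {s : Fin 3} (hi : x i = Sum.inr s)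
    (h : ¬ ∀ j < i, (x j).isLeft = true) : G x i = Sum.inr s := by
  unfold G
  rw [hi, Sum.elim_inr, if_neg h]

theorem F_isLeft (x : ℕ → A) (i : ℕ) : (F x i).isLeft = (x i).isLeft := by
  unfold F
  rcases x i with b | s <;> simp <;> split_ifs <;> rfl

theorem G_isLeft (x : ℕ → A) (i : ℕ) : (G x i).isLeft = (x i).isLeft := by
  unfold G
  rcases x i with b | s <;> simp <;> split_ifs <;> rfl

theorem F_congr {x y : ℕ → A} {n : ℕ} (h : ∀ i < n, x i = y i) : ∀ i < n, F x i = F y i := by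
  intro i hi
  have h1 : (∀ j < i, x j = Sum.inl true) ↔ (∀ j < i, y j = Sum.inl true) :=
    forall₂_congr fun j hj => by rw [h j (hj.trans hi)]
  have h2 : (∀ j < i, (x j).isLeft = true) ↔ (∀ j < i, (y j).isLeft = true) :=
    forall₂_congr fun j hj => by rw [h j (hj.trans hi)]
  unfold F
  simp only [h1, h2, h i hi]

theorem G_congr {x y : ℕ → A} {n : ℕ} (h : ∀ i < n, x i = y i) : ∀ i < n, G x i = G y i := by
  intro i hi
  have h1 : (∀ j < i, x j = Sum.inl false) ↔ (∀ j < i, y j = Sum.inl false) :=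
    forall₂_congr fun j hj => by rw [h j (hj.trans hi)]
  have h2 : (∀ j < i, (x j).isLeft = true) ↔ (∀ j < i, (y j).isLeft = true) :=
    forall₂_congr fun j hj => by rw [h j (hj.trans hi)]
  unfold G
  simp only [h1, h2, h i hi]

theorem F_carry (x : ℕ → A) (i : ℕ) :
    (∀ j < i, F x j = Sum.inl false) ↔ (∀ j < i, x j = Sum.inl true) := by
  induction i with
  | zero => simp
  | succ i ih =>
    rw [Nat.forall_lt_succ_right, Nat.forall_lt_succ_right, ih]
    refine and_congr_right fun h => ?_
    rcases hi : x i with b | s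
    · rw [F_inl_pos hi h]; simp
    · have h1 := F_isLeft x i
      rw [hi] at h1
      constructor
      · intro h2
        rw [h2] at h1
        simp at h1
      · intro h2
        simp at h2

theorem G_carry (x : ℕ → A) (i : ℕ) :
    (∀ j < i, G x j = Sum.inl true) ↔ (∀ j < i, x j = Sum.inl false) := by
  induction i with
  | zero => simp
  | succ i ih =>
    rw [Nat.forall_lt_succ_right, Nat.forall_lt_succ_right, ih]
    refine and_congr_right fun h => ?_
    rcases hi : x i with b | s
    · rw [G_inl_pos hi h]; simp
    · have h1 := G_isLeft x i
      rw [hi] at h1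
      constructor
      · intro h2
        rw [h2] at h1
        simp at h1
      · intro h2
        simp at h2

theorem G_F (x : ℕ → A) : G (F x) = x := by
  funext i
  have hl : (∀ j < i, (F x j).isLeft = true) ↔ (∀ j < i, (x j).isLeft = true) :=
    forall₂_congr fun j _ => by rw [F_isLeft]
  rcases hi : x i with b | s
  · by_cases h : ∀ j < i, x j = Sum.inl true
    · rw [G_inl_pos (F_inl_pos hi h) ((F_carry x i).2 h), Bool.not_not]
    · exact G_inl_neg (F_inl_neg hi h) fun hp => h ((F_carry x i).1 hp)
  · by_cases h : ∀ j < i, (x j).isLeft = true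
    · rw [G_inr_pos (F_inr_pos hi h) (hl.2 h)]
      exact congrArg Sum.inr (by clear hi; revert s; decide)
    · exact G_inr_neg (F_inr_neg hi h) fun hp => h (hl.1 hp)

theorem F_G (x : ℕ → A) : F (G x) = x := by
  funext i
  have hl : (∀ j < i, (G x j).isLeft = true) ↔ (∀ j < i, (x j).isLeft = true) :=
    forall₂_congr fun j _ => by rw [G_isLeft]
  rcases hi : x i with b | s
  · by_cases h : ∀ j < i, x j = Sum.inl false
    · rw [F_inl_pos (G_inl_pos hi h) ((G_carry x i).2 h), Bool.not_not]
    · exact F_inl_neg (G_inl_neg hi h) fun hp => h ((G_carry x i).1 hp)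
  · by_cases h : ∀ j < i, (x j).isLeft = true
    · rw [F_inr_pos (G_inr_pos hi h) (hl.2 h)]
      exact congrArg Sum.inr (by clear hi; revert s; decide)
    · exact F_inr_neg (G_inr_neg hi h) fun hp => h (hl.1 hp)

/-- A prefix-preserving self-map is continuous. -/
theorem continuous_of_congr (H : (ℕ → A) → ℕ → A)
    (hH : ∀ (x y : ℕ → A) (n : ℕ), (∀ i < n, x i = y i) → ∀ i < n, H x i = H y i) :
    Continuous H := by
  refine continuous_pi fun i => ?_
  rw [continuous_iff_continuousAt]
  intro x
  have : ∀ᶠ y in nhds x, ∀ j ∈ Finset.range (i + 1), y j = x j := by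
    rw [Filter.eventually_all_finset]
    intro j _
    exact ((isOpen_discrete ({x j} : Set A)).preimage
      (continuous_apply (A := fun _ : ℕ => A) j)).mem_nhds rfl
  refine ContinuousAt.congr (f := fun _ => H x i) continuousAt_const ?_
  filter_upwards [this] with y hy
  exact (hH y x (i + 1) (fun j hj => hy j (Finset.mem_range.2 hj)) i (Nat.lt_succ_self i)).symm

/-- The model homeomorphism. -/
noncomputable def FH : (ℕ → A) ≃ₜ (ℕ → A) where
  toFun := F
  invFun := G
  left_inv := G_F
  right_inv := F_G
  continuous_toFun := continuous_of_congr F fun _ _ _ h => F_congr h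
  continuous_invFun := continuous_of_congr G fun _ _ _ h => G_congr h

/-- Truncation of a self-map: only the first `n` letters are changed. -/
def trunc (n : ℕ) (H : (ℕ → A) → ℕ → A) (x : ℕ → A) (i : ℕ) : A :=
  if i < n then H x i else x i

theorem trunc_lt {n : ℕ} (H : (ℕ → A) → ℕ → A) {x : ℕ → A} {i : ℕ} (hi : i < n) :
    trunc n H x i = H x i := if_pos hi

theorem trunc_ge {n : ℕ} (H : (ℕ → A) → ℕ → A) {x : ℕ → A} {i : ℕ} (hi : ¬ i < n) :
    trunc n H x i = x i := if_neg hi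

theorem trunc_congr (n : ℕ) (H : (ℕ → A) → ℕ → A)
    (hH : ∀ (x y : ℕ → A) (n : ℕ), (∀ i < n, x i = y i) → ∀ i < n, H x i = H y i)
    (x y : ℕ → A) (m : ℕ) (h : ∀ i < m, x i = y i) : ∀ i < m, trunc n H x i = trunc n H y i := by
  intro i hi
  unfold trunc
  rw [hH x y m h i hi, h i hi]

theorem trunc_inv (n : ℕ) (H K : (ℕ → A) → ℕ → A)
    (hH : ∀ (x y : ℕ → A) (n : ℕ), (∀ i < n, x i = y i) → ∀ i < n, H x i = H y i)
    (hHK : ∀ x, H (K x) = x) (x : ℕ → A) : trunc n H (trunc n K x) = x := by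
  funext i
  by_cases hi : i < n
  · rw [trunc_lt _ hi, hH (trunc n K x) (K x) n (fun j hj => by simp [trunc, hj]) i hi, hHK]
  · rw [trunc_ge _ hi, trunc_ge _ hi]

/-- The perturbation of the model homeomorphism. -/
noncomputable def TH (n : ℕ) : (ℕ → A) ≃ₜ (ℕ → A) where
  toFun := trunc n F
  invFun := trunc n G
  left_inv := trunc_inv n G F (fun _ _ _ h => G_congr h) G_F
  right_inv := trunc_inv n F G (fun _ _ _ h => F_congr h) F_G
  continuous_toFun := continuous_of_congr _ (trunc_congr n F fun _ _ _ h => F_congr h)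
  continuous_invFun := continuous_of_congr _ (trunc_congr n G fun _ _ _ h => G_congr h)

/-- Binary addition of one. -/
theorem testBit_succ_carry (i m : ℕ) : (m + 1).testBit i =
    if (∀ j < i, m.testBit j = true) then !(m.testBit i) else m.testBit i := by
  induction i generalizing m with
  | zero =>
    simp [Nat.testBit_zero]
    grind
  | succ i ih =>
    simp only [Nat.forall_lt_succ_left, Nat.testBit_succ, Nat.testBit_zero]
    rcases Nat.even_or_odd' m with ⟨k, rfl | rfl⟩
    · have h1 : (2 * k + 1) / 2 = k := by omega
      have h2 : (2 * k) / 2 = k := by omega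
      simp [h1, h2]
    · have h1 : (2 * k + 1 + 1) / 2 = k + 1 := by omega
      have h2 : (2 * k + 1) / 2 = k := by omega
      simp [h1, h2, ih]

theorem F_bits {x : ℕ → A} {n m : ℕ} (h : ∀ i < n, x i = Sum.inl (m.testBit i)) :
    ∀ i < n, F x i = Sum.inl ((m + 1).testBit i) := by
  intro i hi
  have h1 : (∀ j < i, x j = Sum.inl true) ↔ (∀ j < i, m.testBit j = true) :=
    forall₂_congr fun j hj => by rw [h j (hj.trans hi)]; simp
  unfold F
  rw [h i hi, testBit_succ_carry, Sum.elim_inl]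
  simp only [h1]
  split_ifs <;> rfl

theorem F_iter_bits {x : ℕ → A} {n m : ℕ} (h : ∀ i < n, x i = Sum.inl (m.testBit i)) (k : ℕ) :
    ∀ i < n, F^[k] x i = Sum.inl ((m + k).testBit i) := by
  induction k with
  | zero => simpa using h
  | succ k ih =>
    rw [Function.iterate_succ_apply', ← add_assoc]
    exact F_bits ih

theorem F_iter_isLeft (x : ℕ → A) (k i : ℕ) : (F^[k] x i).isLeft = (x i).isLeft := by
  induction k with
  | zero => rfl
  | succ k ih => rw [Function.iterate_succ_apply', F_isLeft, ih]

open Fin.NatCast in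
theorem F_iter_special {x : ℕ → A} {i : ℕ} {s : Fin 3} (h : ∀ j < i, (x j).isLeft = true)
    (hi : x i = Sum.inr s) (k : ℕ) : F^[k] x i = Sum.inr (s + (k : Fin 3)) := by
  induction k with
  | zero => simp [hi]
  | succ k ih =>
    rw [Function.iterate_succ_apply']
    rw [F_inr_pos ih fun j hj => by rw [F_iter_isLeft]; exact h j hj]
    simp [add_assoc]

theorem F_iter_after {x : ℕ → A} {i : ℕ} {s : Fin 3} (h : ¬ ∀ j < i, (x j).isLeft = true)
    (hi : x i = Sum.inr s) (k : ℕ) : F^[k] x i = Sum.inr s := by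
  induction k with
  | zero => simp [hi]
  | succ k ih =>
    rw [Function.iterate_succ_apply']
    exact F_inr_neg ih fun hp => h fun j hj => by rw [← F_iter_isLeft x k]; exact hp j hj

theorem F_no_periodic (k : ℕ) (x : ℕ → A) : F^[2 ^ k] x ≠ x := by
  intro hx
  by_cases h : ∃ i, (x i).isLeft = false
  · classical
    have h0 := Nat.find_spec h
    have h1 : ∀ j < Nat.find h, (x j).isLeft = true := fun j hj => by
      simpa using Nat.find_min h hj
    generalize Nat.find h = i at h0 h1
    obtain ⟨s, hs⟩ : ∃ s, x i = Sum.inr s := by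
      rcases hxi : x i with b | s
      · simp [hxi] at h0
      · exact ⟨s, rfl⟩
    have h2 := F_iter_special h1 hs (2 ^ k)
    rw [hx, hs] at h2
    have h3 := congrArg Fin.val (add_eq_left.1 (Sum.inr.inj h2).symm)
    rw [Fin.val_natCast] at h3
    have h4 : 3 ∣ 2 ^ k := Nat.dvd_of_mod_eq_zero h3
    have h5 := Nat.prime_three.dvd_of_dvd_pow h4
    omega
  · push Not at h
    have hp : ∀ i, ∃ b, x i = Sum.inl b := fun i => by
      rcases hxi : x i with b | s
      · exact ⟨b, rfl⟩
      · exact absurd (by simp [hxi]) (h i)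
    choose b hb using hp
    have h1 : ∀ i < k + 1, x i = Sum.inl
        ((Nat.ofBits (n := k + 1) fun j => b j).testBit i) := fun i hi => by
      rw [Nat.testBit_ofBits_lt _ _ hi, hb]
    have h2 := F_iter_bits h1 (2 ^ k) k (Nat.lt_succ_self k)
    rw [hx, h1 k (Nat.lt_succ_self k), add_comm _ (2 ^ k), Nat.testBit_two_pow_add_eq] at h2
    have h3 := Sum.inl.inj h2
    simp at h3

theorem trunc_periodic (n : ℕ) :
    (trunc n F)^[2 ^ n] (fun _ => Sum.inl false) = fun _ => Sum.inl false := by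
  have key : ∀ k i, (trunc n F)^[k] (fun _ => Sum.inl false) i =
      Sum.inl (decide (i < n) && k.testBit i) := by
    intro k
    induction k with
    | zero => simp
    | succ k ih =>
      intro i
      rw [Function.iterate_succ_apply']
      by_cases hi : i < n
      · rw [trunc_lt _ hi, F_bits (n := n) (m := k) (fun j hj => by rw [ih]; simp [hj]) i hi]
        simp [hi]
      · rw [trunc_ge _ hi, ih]; simp [hi]
  funext i
  rw [key, Nat.testBit_two_pow]
  congr 1
  simp
  omega

/-- Replace all letters from position `n` on by a fixed special letter. -/
def S (n : ℕ) (x : ℕ → A) (i : ℕ) : A := if i < n then x i else Sum.inr 0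

theorem F_iter_congr {x y : ℕ → A} {n : ℕ} (h : ∀ i < n, x i = y i) (k : ℕ) :
    ∀ i < n, F^[k] x i = F^[k] y i := by
  induction k with
  | zero => exact h
  | succ k ih =>
    rw [Function.iterate_succ_apply', Function.iterate_succ_apply']
    exact F_congr ih

theorem S_comm (n : ℕ) (x : ℕ → A) : F^[3] (S n x) = S n (F^[3] x) := by
  funext i
  by_cases hi : i < n
  · rw [F_iter_congr (y := x) (n := n) (fun j hj => by simp [S, hj]) 3 i hi]
    simp [S, hi]
  · have h0 : S n x i = Sum.inr 0 := by simp [S, hi]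
    have h1 : S n (F^[3] x) i = Sum.inr 0 := by simp [S, hi]
    rw [h1]
    by_cases h : ∀ j < i, (S n x j).isLeft = true
    · rw [F_iter_special h h0]; rfl
    · exact F_iter_after h h0 3

theorem S_continuous (n : ℕ) : Continuous (S n) :=
  continuous_of_congr _ fun x y m h i hi => by unfold S; rw [h i hi]

end CubeStab

namespace CubeStab

theorem partition_exists {X : Type*} [MetricSpace X] [CompactSpace X]
    [TotallyDisconnectedSpace X] (ε : ℝ) (hε : 0 < ε) :
    ∃ (n : ℕ) (g : X → Fin n), Continuous g ∧ ∀ x y, g x = g y → dist x y < ε := by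
  have hS : {p : X × X | dist p.1 p.2 < ε / 2} ∈ nhdsSet (Set.diagonal X) := by
    rw [mem_nhdsSet_iff_forall]
    rintro ⟨x, y⟩ (rfl : x = y)
    refine IsOpen.mem_nhds (isOpen_lt (by fun_prop) continuous_const) ?_
    simpa using hε
  obtain ⟨n, g, h, hg, hgh⟩ :=
    ContinuousMap.exists_finite_approximation_of_mem_nhds_diagonal (ContinuousMap.id X) hS
  refine ⟨n, g, hg, fun x y hxy => ?_⟩
  have h1 : dist x (h (g x)) < ε / 2 := hgh x
  have h2 : dist y (h (g y)) < ε / 2 := hgh y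
  rw [← hxy] at h2
  have := dist_triangle_right x y (h (g x))
  linarith

theorem partition_card {X : Type*} [MetricSpace X] [CompactSpace X] [PerfectSpace X]
    [TotallyDisconnectedSpace X] (U : Set X) (hU : IsClopen U) (hne : U.Nonempty)
    (ε : ℝ) (hε : 0 < ε) :
    ∃ m0 : ℕ, ∀ m ≥ m0, ∃ c : X → Fin m, Continuous c ∧ (∀ j, ∃ x ∈ U, c x = j) ∧
      ∀ x ∈ U, ∀ y ∈ U, c x = c y → dist x y < ε := by
  classical
  obtain ⟨n, g, hg, hgε⟩ := partition_exists (X := X) ε hε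
  obtain ⟨u, hu⟩ := hne
  let T : Finset (Fin n) := Finset.univ.filter fun j => ∃ x ∈ U, g x = j
  have hT : ∀ x ∈ U, g x ∈ T := fun x hx => by simp only [T, Finset.mem_filter]; exact ⟨Finset.mem_univ _, x, hx, rfl⟩
  let e : T ≃ Fin T.card := T.equivFin
  refine ⟨T.card, fun m hm => ?_⟩
  induction m, hm using Nat.le_induction with
  | base =>
    let r : Fin n → Fin T.card := fun j => if h : j ∈ T then e ⟨j, h⟩ else e ⟨g u, hT u hu⟩
    refine ⟨fun x => r (g x), (continuous_of_discreteTopology (f := r)).comp hg, ?_, ?_⟩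
    · intro j
      obtain ⟨⟨t, ht⟩, rfl⟩ := e.surjective j
      obtain ⟨x, hx, rfl⟩ := (Finset.mem_filter.1 ht).2
      exact ⟨x, hx, by simp only [r, ht, dif_pos]⟩
    · intro x hx y hy hxy
      simp only [r, hT x hx, hT y hy, dif_pos] at hxy
      have := e.injective hxy
      exact hgε x y (congrArg Subtype.val this)
  | succ m hm ih =>
    obtain ⟨c, hc, hs, hd⟩ := ih
    let j0 : Fin m := c u
    have hV : U ∩ c ⁻¹' {j0} ∈ nhds u :=
      (hU.isOpen.inter ((isOpen_discrete _).preimage hc)).mem_nhds ⟨hu, rfl⟩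
    obtain ⟨v, ⟨⟨hvU, hvc⟩, -⟩, hvu⟩ :=
      preperfect_iff_nhds.1 (PerfectSpace.univ_preperfect (α := X)) u (Set.mem_univ u) _ hV
    obtain ⟨W, hW, hvW, huW⟩ := exists_isClopen_of_totally_separated hvu
    refine ⟨fun x => if c x = j0 ∧ x ∈ W then Fin.last m else Fin.castSucc (c x), ?_, ?_, ?_⟩
    · refine Continuous.if ?_ continuous_const (continuous_of_discreteTopology.comp hc)
      intro a ha
      have hcl : IsClopen {x | c x = j0 ∧ x ∈ W} :=
        ((isClopen_discrete ({j0} : Set (Fin m))).preimage hc).inter hW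
      rw [hcl.frontier_eq] at ha
      exact absurd ha (Set.notMem_empty a)
    · intro j
      refine Fin.lastCases ?_ (fun j => ?_) j
      · exact ⟨v, hvU, if_pos ⟨hvc, hvW⟩⟩
      · by_cases hj : j = j0
        · exact ⟨u, hu, (if_neg fun h => huW h.2).trans (by rw [hj])⟩
        · obtain ⟨x, hx, rfl⟩ := hs j
          exact ⟨x, hx, if_neg fun h => hj h.1⟩
    · intro x hx y hy hxy
      refine hd x hx y hy ?_
      beta_reduce at hxy
      split_ifs at hxy with h1 h2 h2
      · rw [h1.1, h2.1]
      · exact absurd hxy.symm (Fin.castSucc_lt_last _).ne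
      · exact absurd hxy (Fin.castSucc_lt_last _).ne
      · exact Fin.castSucc_injective _ hxy

/-- A finite stage of the coding. -/
structure Stage (X : Type*) [MetricSpace X] where
  /-- length of the coding words -/
  N : ℕ
  /-- coding map -/
  q : X → ℕ → A
  cont : Continuous q
  surj : ∀ y : ℕ → A, ∃ x, ∀ i < N, q x i = y i

theorem stage_next {X : Type*} [MetricSpace X] [CompactSpace X] [PerfectSpace X]
    [TotallyDisconnectedSpace X] (s : Stage X) (ε : ℝ) (hε : 0 < ε) :
    ∃ t : Stage X, s.N < t.N ∧ (∀ x, ∀ i < s.N, t.q x i = s.q x i) ∧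
      ∀ x y, (∀ i < t.N, t.q x i = t.q y i) → dist x y < ε := by
  classical
  let w : X → Fin s.N → A := fun x i => s.q x i
  have hw : Continuous w := continuous_pi fun i => (continuous_apply (i : ℕ)).comp s.cont
  have hclopen : ∀ v, IsClopen (w ⁻¹' {v}) := fun v => (isClopen_discrete _).preimage hw
  have hne : ∀ v, (w ⁻¹' {v}).Nonempty := fun v => by
    obtain ⟨x, hx⟩ := s.surj fun i => if h : i < s.N then v ⟨i, h⟩ else Sum.inr 0
    refine ⟨x, ?_⟩
    rw [Set.mem_preimage, Set.mem_singleton_iff]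
    funext i
    have := hx i i.2
    rw [dif_pos i.2] at this
    exact this
  choose m0 hm0 using fun v => partition_card _ (hclopen v) (hne v) ε hε
  let M : ℕ := Finset.univ.sup m0 + 1
  have hM : ∀ v, m0 v ≤ Fintype.card (Fin M → A) := fun v => by
    have h1 : m0 v ≤ M := (Finset.le_sup (f := m0) (Finset.mem_univ v)).trans (Nat.le_succ _)
    have h2 : M < 5 ^ M := Nat.lt_pow_self (by norm_num)
    have h3 : Fintype.card (Fin M → A) = 5 ^ M := by simp [A]
    omega
  choose c hc hcs hcd using fun v => hm0 v _ (hM v)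
  let e := (Fintype.equivFin (Fin M → A)).symm
  have hcw : Continuous fun x => e (c (w x) x) := by
    rw [continuous_iff_continuousAt]
    intro x
    have h1 : ∀ᶠ y in nhds x, w y = w x :=
      hw.continuousAt.eventually (IsOpen.mem_nhds (isOpen_discrete ({w x} : Set _)) rfl)
    refine ContinuousAt.congr (f := fun y => e (c (w x) y))
      (continuous_of_discreteTopology.comp (hc (w x))).continuousAt ?_
    filter_upwards [h1] with y hy
    rw [hy]
  let q : X → ℕ → A := fun x i => if i < s.N then s.q x i else
    if h : i - s.N < M then e (c (w x) x) ⟨i - s.N, h⟩ else Sum.inr 0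
  have hq1 : ∀ x, ∀ i < s.N, q x i = s.q x i := fun x i hi => if_pos hi
  have hq2 : ∀ x (i : Fin M), q x (s.N + i) = e (c (w x) x) i := fun x i => by
    simp [q]
  refine ⟨⟨s.N + M, q, ?_, ?_⟩, ?_, hq1, ?_⟩
  · refine continuous_pi fun i => ?_
    simp only [q]
    split_ifs with h1 h2
    · exact (continuous_apply i).comp s.cont
    · exact (continuous_apply (⟨i - s.N, h2⟩ : Fin M)).comp hcw
    · exact continuous_const
  · intro y
    let v : Fin s.N → A := fun i => y i
    obtain ⟨x, hx, hxc⟩ := hcs v (e.symm fun i => y (s.N + i))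
    have hxv : w x = v := hx
    refine ⟨x, fun i hi => ?_⟩
    by_cases h : i < s.N
    · rw [hq1 x i h]
      exact congrFun hxv ⟨i, h⟩
    · obtain ⟨k, rfl⟩ := Nat.exists_eq_add_of_le (not_lt.1 h)
      have := hq2 x ⟨k, by omega⟩
      rw [hxv, hxc, Equiv.apply_symm_apply] at this
      exact this
  · change s.N < s.N + M
    omega
  · intro x y hxy
    have hxyq : ∀ i < s.N + M, q x i = q y i := hxy
    have h1 : w x = w y := by
      funext i
      have := hxyq i (i.2.trans_le (Nat.le_add_right _ _))
      rwa [hq1 x i i.2, hq1 y i i.2] at this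
    refine hcd (w y) x h1 y rfl (e.injective ?_)
    funext i
    have := hxyq (s.N + i) (by omega)
    rwa [hq2, hq2, h1] at this

/-- Brouwer: every Cantor space is homeomorphic to the full product. -/
theorem exists_homeo (X : Type*) [MetricSpace X] [CompactSpace X] [PerfectSpace X]
    [TotallyDisconnectedSpace X] [Nonempty X] : Nonempty (X ≃ₜ (ℕ → A)) := by
  choose nx h1 h2 h3 using fun (s : Stage X) (k : ℕ) =>
    stage_next s (1 / ((k : ℝ) + 1)) (by positivity)
  let s0 : Stage X := ⟨0, fun _ _ => Sum.inr 0, continuous_const,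
    fun _ => ⟨Classical.arbitrary X, fun i hi => absurd hi (Nat.not_lt_zero i)⟩⟩
  let st : ℕ → Stage X := fun k => Nat.rec s0 (fun k s => nx s k) k
  have hst : ∀ k, st (k + 1) = nx (st k) k := fun k => rfl
  have hN : ∀ k, k ≤ (st k).N := by
    intro k
    induction k with
    | zero => exact Nat.zero_le _
    | succ k ih => rw [hst]; have := h1 (st k) k; omega
  have hcoh : ∀ k j, k ≤ j → ((st k).N ≤ (st j).N ∧
      ∀ x, ∀ i < (st k).N, (st j).q x i = (st k).q x i) := by
    intro k j hkj
    induction j, hkj using Nat.le_induction with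
    | base => exact ⟨le_rfl, fun _ _ _ => rfl⟩
    | succ j hj ih =>
      rw [hst]
      refine ⟨ih.1.trans (h1 (st j) j).le, fun x i hi => ?_⟩
      rw [h2 (st j) j x i (hi.trans_le ih.1), ih.2 x i hi]
  let Φ : X → ℕ → A := fun x i => (st (i + 1)).q x i
  have hΦ : ∀ k x, ∀ i < (st k).N, Φ x i = (st k).q x i := by
    intro k x i hi
    rcases le_total k (i + 1) with h | h
    · exact (hcoh k (i + 1) h).2 x i hi
    · exact ((hcoh (i + 1) k h).2 x i (hN (i + 1))).symm
  have hcont : Continuous Φ :=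
    continuous_pi fun i => (continuous_apply i).comp (st (i + 1)).cont
  have hinj : Function.Injective Φ := by
    intro x y hxy
    by_contra hne
    obtain ⟨k, hk⟩ := exists_nat_one_div_lt (dist_pos.2 hne)
    have h4 := h3 (st k) k x y fun i hi => by
      rw [← hst] at hi ⊢
      rw [← hΦ (k + 1) x i hi, ← hΦ (k + 1) y i hi, hxy]
    linarith
  have hsurj : Function.Surjective Φ := by
    intro y
    have hcl : IsClosed (Set.range Φ) := (isCompact_range hcont).isClosed
    change y ∈ Set.range Φ
    choose x hx using fun k => (st k).surj y
    refine hcl.mem_of_tendsto (f := fun k => Φ (x k)) (b := Filter.atTop) ?_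
      (Filter.Eventually.of_forall fun k => Set.mem_range_self _)
    rw [tendsto_pi_nhds]
    intro i
    refine tendsto_const_nhds.congr' ?_
    filter_upwards [Filter.eventually_ge_atTop (i + 1)] with k hk
    have hi : i < (st k).N := lt_of_lt_of_le hk (hN k)
    rw [hΦ k _ i hi, hx k i hi]
  exact ⟨hcont.homeoOfEquivCompactToT2 (f := Equiv.ofBijective Φ ⟨hinj, hsurj⟩)⟩

end CubeStab

namespace CubeStab

theorem dist_le_dC0 {X : Type*} [MetricSpace X] [CompactSpace X] (f g : X → X) (x : X) :
    dist (f x) (g x) ≤ dC0 f g := by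
  obtain ⟨C, hC⟩ := Metric.isBounded_iff.1 (isCompact_univ (X := X)).isBounded
  exact le_ciSup (f := fun x => dist (f x) (g x))
    ⟨C, by rintro _ ⟨y, rfl⟩; exact hC (Set.mem_univ _) (Set.mem_univ _)⟩ x

theorem dC0_lt {X : Type*} [MetricSpace X] [Nonempty X] (f g : X → X) {ε : ℝ} (hε : 0 < ε)
    (h : ∀ x, dist (f x) (g x) < ε / 2) : dC0 f g < ε :=
  lt_of_le_of_lt (ciSup_le fun x => (h x).le) (by linarith)

theorem unif1 {X : Type*} [MetricSpace X] (φ : X ≃ₜ (ℕ → A)) (ε : ℝ) (hε : 0 < ε) :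
    ∃ n : ℕ, ∀ y z : ℕ → A, (∀ i < n, y i = z i) → dist (φ.symm y) (φ.symm z) < ε := by
  let _ : MetricSpace (ℕ → A) := PiNat.metricSpace
  have hu : UniformContinuous φ.symm :=
    CompactSpace.uniformContinuous_of_continuous φ.symm.continuous
  obtain ⟨δ, hδ, h⟩ := Metric.uniformContinuous_iff.1 hu ε hε
  obtain ⟨n, hn⟩ := exists_pow_lt_of_lt_one hδ (by norm_num : (1 / 2 : ℝ) < 1)
  refine ⟨n, fun y z hyz => h (lt_of_le_of_lt ?_ hn)⟩
  exact PiNat.mem_cylinder_iff_dist_le.1 (PiNat.mem_cylinder_iff.2 hyz)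

theorem unif2 {X : Type*} [MetricSpace X] [CompactSpace X] (φ : X ≃ₜ (ℕ → A)) (n : ℕ) :
    ∃ δ > 0, ∀ x y : X, dist x y < δ → ∀ i < n, φ x i = φ y i := by
  let _ : MetricSpace (ℕ → A) := PiNat.metricSpace
  have hu : UniformContinuous φ := CompactSpace.uniformContinuous_of_continuous φ.continuous
  obtain ⟨δ, hδ, h⟩ := Metric.uniformContinuous_iff.1 hu ((1 / 2) ^ n) (by positivity)
  exact ⟨δ, hδ, fun x y hxy i hi => PiNat.apply_eq_of_dist_lt (h hxy) hi.le⟩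

end CubeStab

/-- On any Cantor space there is a homeomorphism `f` such that `f³` is
topologically stable but `f` is not. -/
theorem exists_cube_topologicallyStable_not_topologicallyStable
    (X : Type*) [MetricSpace X] [CompactSpace X] [PerfectSpace X]
    [TotallyDisconnectedSpace X] [Nonempty X] :
    ∃ f : X ≃ₜ X, TopologicallyStable ((f.trans f).trans f) ∧
      ¬ TopologicallyStable f := by
  obtain ⟨φ⟩ := CubeStab.exists_homeo X
  refine ⟨(φ.trans CubeStab.FH).trans φ.symm, ?_, ?_⟩
  · intro ε hε
    obtain ⟨n, hn⟩ := CubeStab.unif1 φ (ε / 2) (by linarith)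
    obtain ⟨δ, hδ, hd⟩ := CubeStab.unif2 φ n
    refine ⟨δ, hδ, fun g hg => ⟨fun x => φ.symm (CubeStab.S n (φ x)), ?_, ?_, ?_⟩⟩
    · exact φ.symm.continuous.comp ((CubeStab.S_continuous n).comp φ.continuous)
    · refine CubeStab.dC0_lt _ _ hε fun x => ?_
      have := hn (CubeStab.S n (φ x)) (φ x) fun i hi => by simp [CubeStab.S, hi]
      simpa using this
    · funext x
      have h1 := hd _ _ (lt_of_le_of_lt (CubeStab.dist_le_dC0 _ _ x)
        (lt_of_le_of_lt (le_max_left _ _) hg))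
      have h2 : ∀ i < n, CubeStab.F^[3] (φ x) i = φ (g x) i := by
        intro i hi
        have := h1 i hi
        simpa [CubeStab.FH] using this
      have h3 : CubeStab.S n (φ (g x)) = CubeStab.S n (CubeStab.F^[3] (φ x)) := by
        funext i
        unfold CubeStab.S
        split_ifs with hi
        · rw [h2 i hi]
        · rfl
      simp only [Function.comp_apply]
      rw [h3, ← CubeStab.S_comm]
      simp [CubeStab.FH]
  · intro hst
    obtain ⟨δ, hδ, h⟩ := hst 1 one_pos
    obtain ⟨n, hn⟩ := CubeStab.unif1 φ (δ / 2) (by linarith)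
    obtain ⟨h, -, -, hh⟩ := h ((φ.trans (CubeStab.TH n)).trans φ.symm) (max_lt
      (CubeStab.dC0_lt _ _ hδ fun x => hn _ _ fun i hi => by
        simp [CubeStab.FH, CubeStab.TH, CubeStab.trunc, hi])
      (CubeStab.dC0_lt _ _ hδ fun x => hn _ _ fun i hi => by
        simp [CubeStab.FH, CubeStab.TH, CubeStab.trunc, hi]))
    have key : ∀ (k : ℕ) (y : ℕ → CubeStab.A),
        φ (h (φ.symm ((CubeStab.trunc n CubeStab.F)^[k] y))) =
          CubeStab.F^[k] (φ (h (φ.symm y))) := by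
      intro k
      induction k with
      | zero => intro y; rfl
      | succ k ih =>
        intro y
        rw [Function.iterate_succ_apply, Function.iterate_succ_apply, ih]
        congr 1
        have := congrArg φ (congrFun hh (φ.symm y))
        simpa [CubeStab.FH, CubeStab.TH] using this
    have h1 := key (2 ^ n) fun _ => Sum.inl false
    rw [CubeStab.trunc_periodic] at h1
    exact CubeStab.F_no_periodic n _ h1.symm
end

section
/- Let (X,d) be a Cantor space. If a homeomorphism f of X is topologically stable in the strong sense, then f has the shadowing property and the set Ω(f) of non-wandering points of f is finite. -/
/-! Common definitions: distances on maps/homeomorphisms of a metric space,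
topological stability and shadowing-type properties. -/

variable {X : Type*} [MetricSpace X]

/-! ### Brouwer's characterisation of the Cantor space -/

namespace CantorAux

open Set Filter Topology TopologicalSpace

section Brouwer

variable {A : Type*} [TopologicalSpace A] [CompactSpace A] [T2Space A]
  [TotallyDisconnectedSpace A] [PerfectSpace A]

/-- A nonempty clopen set can be split in two nonempty clopen pieces deciding a given clopen. -/
lemma exists_split (C U : Clopens A) (hC : (C : Set A).Nonempty) :
    ∃ S : Clopens A, ((C ⊓ S : Clopens A) : Set A).Nonempty ∧
      ((C ⊓ Sᶜ : Clopens A) : Set A).Nonempty ∧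
      ∀ x ∈ C, ∀ y ∈ C, (x ∈ S ↔ y ∈ S) → (x ∈ U ↔ y ∈ U) := by
  by_cases h : ((C ⊓ U : Clopens A) : Set A).Nonempty ∧ ((C ⊓ Uᶜ : Clopens A) : Set A).Nonempty
  · exact ⟨U, h.1, h.2, fun x _ y _ h => h⟩
  · have hU : ∀ x ∈ C, ∀ y ∈ C, (x ∈ U ↔ y ∈ U) := by
      intro x hx y hy
      by_contra hne
      apply h
      by_cases hxU : x ∈ U
      · have hyU : y ∉ U := fun hy => hne (by tauto)
        exact ⟨⟨x, hx, hxU⟩, ⟨y, hy, hyU⟩⟩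
      · have hyU : y ∈ U := by tauto
        exact ⟨⟨y, hy, hyU⟩, ⟨x, hx, hxU⟩⟩
    obtain ⟨x, hx⟩ := hC
    have hpre := IsOpen.preperfect C.isOpen
    rw [preperfect_iff_nhds] at hpre
    obtain ⟨y, hy, hyx⟩ := hpre x hx univ univ_mem
    obtain ⟨V, hV, hxV, hVy⟩ := compact_exists_isClopen_in_isOpen
      (isOpen_compl_singleton (x := y)) (show x ∈ ({y} : Set A)ᶜ from fun h => hyx h.symm)
    refine ⟨⟨V, hV⟩, ⟨x, hx, hxV⟩, ⟨y, hy.2, fun h => hVy h rfl⟩, fun x hx y hy _ => hU x hx y hy⟩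

theorem nonempty_homeo_cantor [SecondCountableTopology A] [Nonempty A] :
    Nonempty (A ≃ₜ (ℕ → Bool)) := by
  classical
  have hc : Countable (Clopens A) := Clopens.countable_iff_secondCountable.mpr inferInstance
  obtain ⟨U, hU⟩ := exists_surjective_nat (Clopens A)
  have key : ∀ (C : Clopens A) (n : ℕ), ∃ S : Clopens A, (C : Set A).Nonempty →
      ((C ⊓ S : Clopens A) : Set A).Nonempty ∧
      ((C ⊓ Sᶜ : Clopens A) : Set A).Nonempty ∧
      ∀ x ∈ C, ∀ y ∈ C, (x ∈ S ↔ y ∈ S) → (x ∈ U n ↔ y ∈ U n) := by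
    intro C n
    by_cases h : (C : Set A).Nonempty
    · obtain ⟨S, hS⟩ := exists_split C (U n) h
      exact ⟨S, fun _ => hS⟩
    · exact ⟨⊤, fun h' => absurd h' h⟩
  choose S hS using key
  let C : List Bool → Clopens A := fun l => List.rec ⊤
    (fun b l ih => if b then ih ⊓ S ih l.length else ih ⊓ (S ih l.length)ᶜ) l
  have C0 : C [] = ⊤ := rfl
  have Ct : ∀ l, C (true :: l) = C l ⊓ S (C l) l.length := fun l => rfl
  have Cf : ∀ l, C (false :: l) = C l ⊓ (S (C l) l.length)ᶜ := fun l => rfl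
  have Cne : ∀ l : List Bool, (SetLike.coe (C l)).Nonempty := by
    intro l
    induction l with
    | nil => rw [C0]; exact univ_nonempty
    | cons b l ih =>
      cases b
      · rw [Cf]; exact (hS _ _ ih).2.1
      · rw [Ct]; exact (hS _ _ ih).1
  let w : A → ℕ → List Bool := fun x n => Nat.rec []
    (fun _ l => decide (x ∈ S (C l) l.length) :: l) n
  have w0 : ∀ x, w x 0 = [] := fun x => rfl
  have ws : ∀ x n, w x (n+1) = decide (x ∈ S (C (w x n)) (w x n).length) :: w x n :=
    fun x n => rfl
  have wl : ∀ x n, (w x n).length = n := by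
    intro x n
    induction n with
    | zero => rfl
    | succ n ih => rw [ws, List.length_cons, ih]
  have wmem : ∀ x n, x ∈ C (w x n) := by
    intro x n
    induction n with
    | zero => rw [w0, C0]; exact mem_univ x
    | succ n ih =>
      rw [ws]
      by_cases h : x ∈ S (C (w x n)) (w x n).length
      · rw [decide_eq_true h, Ct]; exact ⟨ih, h⟩
      · rw [decide_eq_false h, Cf]; exact ⟨ih, h⟩
  have wloc : ∀ n x, ∀ᶠ y in 𝓝 x, w y n = w x n := by
    intro n x
    induction n with
    | zero => exact Eventually.of_forall fun y => rfl
    | succ n ih =>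
      have h2 : ∀ V : Clopens A, ∀ᶠ y in 𝓝 x, (y ∈ V ↔ x ∈ V) := by
        intro V
        by_cases h : x ∈ V
        · filter_upwards [V.isOpen.mem_nhds h] with y hy
          exact ⟨fun _ => h, fun _ => hy⟩
        · filter_upwards [Vᶜ.isOpen.mem_nhds (show x ∈ Vᶜ from h)] with y hy
          exact ⟨fun h' => absurd h' hy, fun h' => absurd h' h⟩
      filter_upwards [ih, h2 (S (C (w x n)) (w x n).length)] with y hy hy2
      rw [ws, ws, hy]
      simp only [hy2]
  let φ : A → ℕ → Bool := fun x n => decide (x ∈ S (C (w x n)) n)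
  have ws' : ∀ x n, w x (n+1) = φ x n :: w x n := by
    intro x n
    rw [ws]; simp only [wl, φ]
  have φcont : Continuous φ := by
    refine continuous_pi fun n => ?_
    refine (IsLocallyConstant.iff_eventually_eq _).mpr (fun x => ?_) |>.continuous
    filter_upwards [wloc (n+1) x] with y hy
    rw [ws', ws'] at hy
    exact (List.cons.inj hy).1
  have φinj : Function.Injective φ := by
    intro x y hxy
    have hw : ∀ n, w x n = w y n := by
      intro n
      induction n with
      | zero => rfl
      | succ n ih => rw [ws', ws', ih, hxy]
    by_contra hne
    obtain ⟨V, hV, hxV, hVy⟩ := compact_exists_isClopen_in_isOpen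
      (isOpen_compl_singleton (x := y)) (show x ∈ ({y} : Set A)ᶜ from hne)
    obtain ⟨n, hn⟩ := hU ⟨V, hV⟩
    have h1 := (hS (C (w x n)) n (Cne _)).2.2 x (wmem x n) y (by rw [hw]; exact wmem y n)
    have h2 : φ x n = φ y n := by rw [hxy]
    simp only [φ, decide_eq_decide] at h2
    rw [← hw] at h2
    have h3 := h1 h2
    rw [hn] at h3
    exact hVy (h3.1 hxV) rfl
  have φsurj : Function.Surjective φ := by
    intro s
    let l : ℕ → List Bool := fun n => Nat.rec [] (fun n l => s n :: l) n
    have ls : ∀ n, l (n+1) = s n :: l n := fun n => rfl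
    have ll : ∀ n, (l n).length = n := by
      intro n
      induction n with
      | zero => rfl
      | succ n ih => rw [ls, List.length_cons, ih]
    have hanti : ∀ n, SetLike.coe (C (l (n+1))) ⊆ SetLike.coe (C (l n)) := by
      intro n x hx
      rw [ls] at hx
      cases h : s n
      · rw [h, Cf] at hx; exact hx.1
      · rw [h, Ct] at hx; exact hx.1
    obtain ⟨x, hx⟩ := IsCompact.nonempty_iInter_of_sequence_nonempty_isCompact_isClosed
      (fun n => SetLike.coe (C (l n))) hanti (fun n => Cne _) (C (l 0)).isClosed.isCompact
      (fun n => (C (l n)).isClosed)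
    rw [mem_iInter] at hx
    have h1 : ∀ n, w x n = l n → φ x n = s n := by
      intro n hn
      have h2 := hx (n+1)
      simp only [φ]
      rw [hn]
      rw [ls] at h2
      cases h : s n
      · rw [h, Cf, ll] at h2; exact decide_eq_false h2.2
      · rw [h, Ct, ll] at h2; exact decide_eq_true h2.2
    have h3 : ∀ n, w x n = l n := by
      intro n
      induction n with
      | zero => rfl
      | succ n ih => rw [ws', ls, ih, h1 n ih]
    exact ⟨x, funext fun n => h1 n (h3 n)⟩
  exact ⟨Continuous.homeoOfEquivCompactToT2 (f := Equiv.ofBijective φ ⟨φinj, φsurj⟩) φcont⟩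

end Brouwer

section Fibers

variable {A B : Type*} [TopologicalSpace A] [CompactSpace A] [T2Space A]
  [TotallyDisconnectedSpace A] [PerfectSpace A] [SecondCountableTopology A]
  [TopologicalSpace B] [CompactSpace B] [T2Space B]
  [TotallyDisconnectedSpace B] [PerfectSpace B] [SecondCountableTopology B]

lemma fiber_homeo {E : Type*} [TopologicalSpace E] [DiscreteTopology E] (u : A → E)
    (hu : Continuous u) (hs : Function.Surjective u) (e : E) :
    Nonempty ({a // u a = e} ≃ₜ (ℕ → Bool)) := by
  have hclopen : IsClopen {a | u a = e} := (isClopen_discrete {e}).preimage hu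
  have : CompactSpace {a // u a = e} := isCompact_iff_compactSpace.mp hclopen.isClosed.isCompact
  have : Nonempty {a // u a = e} := let ⟨a, ha⟩ := hs e; ⟨⟨a, ha⟩⟩
  have : PerfectSpace {a // u a = e} := by
    rw [perfectSpace_def, preperfect_iff_nhds]
    rintro ⟨x, hx⟩ - V hV
    obtain ⟨W, hW, hWV⟩ := (mem_nhds_subtype _ _ _).mp hV
    have hpre := IsOpen.preperfect hclopen.isOpen
    rw [preperfect_iff_nhds] at hpre
    obtain ⟨y, hy, hyx⟩ := hpre x hx W hW
    exact ⟨⟨y, hy.2⟩, ⟨hWV hy.1, mem_univ _⟩, fun h => hyx (congrArg Subtype.val h)⟩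
  have : SecondCountableTopology {a // u a = e} :=
    IsInducing.subtypeVal.secondCountableTopology
  exact nonempty_homeo_cantor

theorem exists_homeo_of_labels {E : Type*} [TopologicalSpace E] [DiscreteTopology E]
    (u : A → E) (hu : Continuous u) (hus : Function.Surjective u)
    (v : B → E) (hv : Continuous v) (hvs : Function.Surjective v) :
    ∃ ψ : A ≃ₜ B, ∀ a, v (ψ a) = u a := by
  have hh : ∀ e, Nonempty ({a // u a = e} ≃ₜ {b // v b = e}) := fun e =>
    let ⟨p⟩ := fiber_homeo u hu hus e
    let ⟨q⟩ := fiber_homeo v hv hvs e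
    ⟨p.trans q.symm⟩
  let p : ∀ e, {a // u a = e} ≃ₜ {b // v b = e} := fun e => (hh e).some
  let F : A ≃ B := Equiv.ofFiberEquiv (f := u) (g := v) fun e => (p e).toEquiv
  have hF : ∀ e (a : A) (ha : u a = e), F a = (p e ⟨a, ha⟩ : B) := by
    rintro e a rfl
    rfl
  have hcont : Continuous F := by
    rw [continuous_iff_continuousAt]
    intro x
    have hop : IsOpen {a | u a = u x} := (isOpen_discrete {u x}).preimage hu
    have h1 : ContinuousOn F {a | u a = u x} := by
      rw [continuousOn_iff_continuous_domRestrict]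
      have : ({a | u a = u x}).domRestrict F = fun a => (p (u x) a : B) := by
        funext a
        exact hF (u x) a.1 a.2
      rw [this]
      exact continuous_subtype_val.comp (p (u x)).continuous
    exact h1.continuousAt (hop.mem_nhds rfl)
  exact ⟨hcont.homeoOfEquivCompactToT2, fun a => Equiv.ofFiberEquiv_map _ a⟩

end Fibers

section Product

instance perfect_cantor : PerfectSpace (ℕ → Bool) := by
  rw [perfectSpace_def, preperfect_iff_nhds]
  intro s _ V hV
  have h : Tendsto (fun n => Function.update s n (!s n)) atTop (𝓝 s) := by
    rw [tendsto_pi_nhds]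
    intro i
    refine tendsto_const_nhds.congr' ?_
    filter_upwards [eventually_gt_atTop i] with n hn
    rw [Function.update_of_ne (by omega)]
  obtain ⟨n, hn⟩ := (h.eventually hV).exists
  refine ⟨_, ⟨hn, mem_univ _⟩, fun he => ?_⟩
  have := congrFun he n
  simp at this

instance perfect_prod {Z B : Type*} [TopologicalSpace Z] [TopologicalSpace B] [PerfectSpace B] :
    PerfectSpace (Z × B) := by
  rw [perfectSpace_def, preperfect_iff_nhds]
  rintro ⟨z, b⟩ _ V hV
  have h : Tendsto (fun b' => (z, b')) (𝓝 b) (𝓝 (z, b)) :=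
    (Continuous.prodMk_right z).tendsto b
  have hpre := (PerfectSpace.univ_preperfect (α := B))
  rw [preperfect_iff_nhds] at hpre
  obtain ⟨y, hy, hyx⟩ := hpre b (mem_univ _) _ (h hV)
  exact ⟨(z, y), ⟨hy.1, mem_univ _⟩, fun he => hyx (congrArg Prod.snd he)⟩

end Product

/-! ### The key perturbation lemma -/

section Key

variable {A : Type*} [MetricSpace A] [CompactSpace A]

lemma dist_le_dC0 (f g : A → A) (x : A) : dist (f x) (g x) ≤ dC0 f g := by
  refine le_ciSup (f := fun x => dist (f x) (g x)) ⟨Metric.diam (univ : Set A), ?_⟩ x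
  rintro _ ⟨y, rfl⟩
  exact Metric.dist_le_diam_of_mem isCompact_univ.isBounded (mem_univ _) (mem_univ _)

lemma exists_cells [TotallyDisconnectedSpace A] (δ : ℝ) (hδ : 0 < δ) :
    ∃ (k : ℕ) (c : A → Fin k), Continuous c ∧ Function.Surjective c ∧
      ∀ x y, c x = c y → dist x y < δ := by
  have hS : {p : A × A | dist p.1 p.2 < δ / 2} ∈ nhdsSet (diagonal A) := by
    refine IsOpen.mem_nhdsSet (isOpen_lt (by fun_prop) continuous_const) |>.mpr ?_
    rintro ⟨x, y⟩ (rfl : x = y)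
    simpa using hδ
  obtain ⟨n, g, h, hg, hd⟩ := ContinuousMap.exists_finite_approximation_of_mem_nhds_diagonal
    (ContinuousMap.id A) hS
  let e : range g ≃ Fin (Nat.card (range g)) := Finite.equivFin _
  refine ⟨_, fun x => e ⟨g x, mem_range_self x⟩, ?_, ?_, fun x y hxy => ?_⟩
  · exact continuous_of_discreteTopology.comp (hg.subtype_mk _)
  · intro i
    obtain ⟨⟨_, x, rfl⟩, hj⟩ := e.surjective i
    exact ⟨x, hj⟩
  replace hxy : g x = g y := congrArg Subtype.val (e.injective hxy)
  have h1 : dist x (h (g x)) < δ / 2 := hd x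
  have h2 : dist y (h (g y)) < δ / 2 := hd y
  rw [hxy] at h1
  have := dist_triangle_right x y (h (g y))
  linarith

theorem key [PerfectSpace A] [TotallyDisconnectedSpace A] [Nonempty A] (f : A ≃ₜ A)
    (hf : STopologicallyStable f) (ε : ℝ) (hε : 0 < ε) :
    ∃ (k : ℕ) (c : A → Fin k), Continuous c ∧ Function.Surjective c ∧ (∀ x y, c x = c y → dist x y ≤ ε) ∧
      ∀ (Y : Type) [TopologicalSpace Y] [CompactSpace Y] [T2Space Y] [SecondCountableTopology Y]
        [TotallyDisconnectedSpace Y] [PerfectSpace Y] (G : Y ≃ₜ Y) (l : Y → Fin k),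
        Continuous l →
        (∀ i j, (∃ y, l y = i ∧ l (G y) = j) ↔ ∃ x, c x = i ∧ c (f x) = j) →
        ∃ H : Y → A, Continuous H ∧ Function.Surjective H ∧ (∀ y, H (G y) = f (H y)) ∧
          ∀ y x, c x = l y → dist (H y) x ≤ ε := by
  obtain ⟨δ, hδ, hstab⟩ := hf (ε / 2) (by positivity)
  have huc := CompactSpace.uniformContinuous_of_continuous f.symm.continuous
  rw [Metric.uniformContinuous_iff] at huc
  obtain ⟨δ', hδ', huc⟩ := huc (δ / 2) (by positivity)
  obtain ⟨k, c, hc, hcs, hcd⟩ := exists_cells (A := A) (min (ε / 2) (min (δ / 2) δ'))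
    (by positivity)
  refine ⟨k, c, hc, hcs, fun x y hxy => ?_, ?_⟩
  · have := (hcd x y hxy).le.trans (min_le_left _ _)
    linarith
  intro Y _ _ _ _ _ _ G l hl hR
  let E := {p : Fin k × Fin k // ∃ x, c x = p.1 ∧ c (f x) = p.2}
  let u : A → E := fun x => ⟨(c x, c (f x)), x, rfl, rfl⟩
  let v : Y → E := fun y => ⟨(l y, l (G y)), (hR _ _).1 ⟨y, rfl, rfl⟩⟩
  have hu : Continuous u := (hc.prodMk (hc.comp f.continuous)).subtype_mk _
  have hv : Continuous v := (hl.prodMk (hl.comp G.continuous)).subtype_mk _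
  have hus : Function.Surjective u := by
    rintro ⟨⟨i, j⟩, x, hi, hj⟩
    exact ⟨x, Subtype.ext (Prod.ext hi hj)⟩
  have hvs : Function.Surjective v := by
    rintro ⟨⟨i, j⟩, h⟩
    obtain ⟨y, hi, hj⟩ := (hR i j).2 h
    exact ⟨y, Subtype.ext (Prod.ext hi hj)⟩
  obtain ⟨ψ, hψ⟩ := exists_homeo_of_labels u hu hus v hv hvs
  have h1 : ∀ x, l (ψ x) = c x := fun x => congrArg (fun e : E => e.1.1) (hψ x)
  have h2 : ∀ x, l (G (ψ x)) = c (f x) := fun x => congrArg (fun e : E => e.1.2) (hψ x)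
  let g : A ≃ₜ A := (ψ.trans G).trans ψ.symm
  have hg : ∀ x, g x = ψ.symm (G (ψ x)) := fun x => rfl
  have hcg : ∀ x, c (g x) = c (f x) := by
    intro x
    rw [← h1, hg, Homeomorph.apply_symm_apply, h2]
  have hD : DH f g < δ := by
    have hle : DH f g ≤ δ / 2 := by
      refine max_le (ciSup_le fun x => ?_) (ciSup_le fun x => ?_)
      · have := hcd _ _ (hcg x).symm
        exact this.le.trans ((min_le_right _ _).trans (min_le_left _ _))
      · have h3 := hcd _ _ (hcg (g.symm x))
        rw [Homeomorph.apply_symm_apply] at h3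
        have h4 := huc (h3.trans_le ((min_le_right _ _).trans (min_le_right _ _)))
        rw [Homeomorph.symm_apply_apply] at h4
        exact h4.le
    linarith
  obtain ⟨h, hcont, hsurj, hd, hcomm⟩ := hstab g hD
  refine ⟨h ∘ ψ.symm, hcont.comp ψ.symm.continuous, hsurj.comp ψ.symm.surjective, ?_, ?_⟩
  · intro y
    have := congrFun hcomm (ψ.symm y)
    simp only [Function.comp_apply, hg, Homeomorph.apply_symm_apply] at this
    exact this
  · intro y x hxy
    have h3 : c (ψ.symm y) = c x := by
      rw [← h1, Homeomorph.apply_symm_apply, hxy]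
    have h4 := (hcd _ _ h3).le.trans (min_le_left _ _)
    have h5 : dist (h (ψ.symm y)) (id (ψ.symm y)) ≤ dC0 h id := dist_le_dC0 h id _
    have h6 := dist_triangle (h (ψ.symm y)) (ψ.symm y) x
    simp only [id] at h5
    simp only [Function.comp_apply]
    linarith

lemma key_iterate {A Y : Type*} [TopologicalSpace A] [TopologicalSpace Y] {G : Y ≃ₜ Y} {f : A ≃ₜ A} {H : Y → A}
    (h : ∀ y, H (G y) = f (H y)) (n : ℕ) (y : Y) : (f : A → A)^[n] (H y) = H (G^[n] y) := by
  have : Function.Semiconj H G f := h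
  exact (this.iterate_right n y).symm

end Key

/-! ### Vertex shifts -/

section Shift

/-- Bi-infinite paths in a finite directed graph. -/
abbrev Path {k : ℕ} (R : Fin k → Fin k → Prop) : Type :=
  {w : ℤ → Fin k // ∀ n, R (w n) (w (n + 1))}

variable {k : ℕ} (R : Fin k → Fin k → Prop)

instance : CompactSpace (Path R) := by
  apply isCompact_iff_compactSpace.mp
  apply IsClosed.isCompact
  have : {w : ℤ → Fin k | ∀ n, R (w n) (w (n + 1))} =
      ⋂ n : ℤ, (fun w : ℤ → Fin k => (w n, w (n + 1))) ⁻¹' {p | R p.1 p.2} := by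
    ext w; simp
  change IsClosed {w : ℤ → Fin k | ∀ n, R (w n) (w (n + 1))}
  rw [this]
  exact isClosed_iInter fun n => (isClosed_discrete _).preimage (by fun_prop)

instance : SecondCountableTopology (Path R) :=
  IsInducing.subtypeVal.secondCountableTopology

/-- The shift on bi-infinite paths, times the identity of the Cantor space. -/
def shift : (Path R × (ℕ → Bool)) ≃ₜ (Path R × (ℕ → Bool)) where
  toFun p := (⟨fun n => p.1.1 (n + 1), fun n => p.1.2 (n + 1)⟩, p.2)
  invFun p := (⟨fun n => p.1.1 (n - 1), fun n => by
    have := p.1.2 (n - 1)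
    rwa [show n - 1 + 1 = n + 1 - 1 by ring] at this⟩, p.2)
  left_inv p := by
    ext <;> simp
  right_inv p := by
    ext <;> simp
  continuous_toFun := by
    refine Continuous.prodMk (Continuous.subtype_mk (continuous_pi fun n => ?_) _) continuous_snd
    exact (continuous_apply (n + 1)).comp (continuous_subtype_val.comp continuous_fst)
  continuous_invFun := by
    refine Continuous.prodMk (Continuous.subtype_mk (continuous_pi fun n => ?_) _) continuous_snd
    exact (continuous_apply (n - 1)).comp (continuous_subtype_val.comp continuous_fst)

lemma shift_iterate (m : ℕ) (p : Path R × (ℕ → Bool)) (n : ℤ) :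
    ((shift R)^[m] p).1.1 n = p.1.1 (n + m) := by
  induction m generalizing p with
  | zero => simp
  | succ m ih =>
    rw [Function.iterate_succ_apply, ih]
    change p.1.1 (n + m + 1) = _
    rw [show n + (m : ℤ) + 1 = n + ((m + 1 : ℕ) : ℤ) by push_cast; ring]

lemma shift_iterate_snd (m : ℕ) (p : Path R × (ℕ → Bool)) :
    ((shift R)^[m] p).2 = p.2 := by
  induction m generalizing p with
  | zero => rfl
  | succ m ih =>
    rw [Function.iterate_succ_apply, ih]
    rfl

/-- The label of a path is its zeroth vertex. -/
def lab (p : Path R × (ℕ → Bool)) : Fin k := p.1.1 0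

lemma continuous_lab : Continuous (lab R) :=
  (continuous_apply 0).comp (continuous_subtype_val.comp continuous_fst)

lemma lab_iterate (m : ℕ) (p : Path R × (ℕ → Bool)) :
    lab R ((shift R)^[m] p) = p.1.1 m := by
  unfold lab
  rw [shift_iterate, zero_add]

variable {R}

/-- One-sided paths extend to bi-infinite paths. -/
lemma exists_path (hR : ∀ j, ∃ i, R i j) (a : ℕ → Fin k) (ha : ∀ n, R (a n) (a (n + 1))) :
    ∃ w : Path R, ∀ n : ℕ, w.1 n = a n := by
  choose τ hτ using hR
  refine ⟨⟨fun n => Int.rec (fun n => a n) (fun n => τ^[n + 1] (a 0)) n, ?_⟩, fun n => rfl⟩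
  rintro (n | n)
  · exact ha n
  · rcases n with _ | n
    · exact hτ (a 0)
    · have h1 : Int.negSucc (n + 1) + 1 = Int.negSucc n := by omega
      rw [h1]
      change R (τ^[n + 1 + 1] (a 0)) (τ^[n + 1] (a 0))
      rw [Function.iterate_succ_apply']
      exact hτ _

lemma exists_periodic_path (m : ℕ) (hm : 0 < m) (a : ℕ → Fin k)
    (ha : ∀ n, R (a n) (a (n + 1))) (h0 : a m = a 0) :
    ∃ w : Path R, w.1 0 = a 0 ∧ ∀ n : ℤ, w.1 (n + m) = w.1 n := by
  refine ⟨⟨fun n => a (n % m).toNat, fun n => ?_⟩, by simp, fun n => by simp⟩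
  have hm' : (0 : ℤ) < m := by exact_mod_cast hm
  have h1 := Int.emod_nonneg n hm'.ne'
  have h2 := Int.emod_lt_of_pos n hm'
  by_cases h : n % m + 1 = m
  · have h3 : (n + 1) % m = 0 := by
      rw [← Int.emod_add_emod, h]
      simp
    have h4 : (n % m).toNat + 1 = m := by omega
    have h5 := ha (n % m).toNat
    rw [h4, h0] at h5
    change R (a _) (a ((n + 1) % m).toNat)
    rw [h3]
    exact h5
  · have h3 : (n + 1) % m = n % m + 1 := by
      rw [← Int.emod_add_emod]
      exact Int.emod_eq_of_lt (by omega) (by omega)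
    change R (a _) (a ((n + 1) % m).toNat)
    rw [h3, show (n % m + 1).toNat = (n % m).toNat + 1 by omega]
    exact ha _

end Shift

section ShadowPeriodic

variable {A : Type*} [MetricSpace A] [CompactSpace A] [PerfectSpace A]
  [TotallyDisconnectedSpace A] [Nonempty A]

/-- `key` applied to the full vertex shift. -/
lemma key_shift (f : A ≃ₜ A) (hf : STopologicallyStable f) (ε : ℝ) (hε : 0 < ε) :
    ∃ (k : ℕ) (c : A → Fin k), Continuous c ∧ Function.Surjective c ∧ (∀ x y, c x = c y → dist x y ≤ ε) ∧
      ∃ H : Path (fun i j => ∃ x, c x = i ∧ c (f x) = j) × (ℕ → Bool) → A,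
        (∀ y, H (shift _ y) = f (H y)) ∧
          ∀ y x, c x = lab _ y → dist (H y) x ≤ ε := by
  obtain ⟨k, c, hc, hcs, hcd, hk⟩ := key f hf ε hε
  refine ⟨k, c, hc, hcs, hcd, ?_⟩
  obtain ⟨H, -, -, h1, h2⟩ := hk _ (shift (fun i j => ∃ x, c x = i ∧ c (f x) = j)) (lab _)
    (continuous_lab _) (by
      intro i j
      constructor
      · rintro ⟨y, rfl, rfl⟩
        exact y.1.2 0
      · rintro ⟨x, rfl, rfl⟩
        let b : ℤ → A := fun n => (f.toEquiv ^ n : Equiv.Perm A) x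
        have hb : ∀ n, b (n + 1) = f (b n) := by
          intro n
          simp only [b]
          rw [add_comm, zpow_add, zpow_one]
          rfl
        refine ⟨(⟨fun n => c (b n), fun n => ⟨b n, rfl, congrArg c (hb n).symm⟩⟩, fun _ => true), ?_, ?_⟩
        · rfl
        · change c (b (0 + 1)) = c (f x)
          rw [hb]
          rfl)
  exact ⟨H, h1, h2⟩

theorem hasShadowing (f : A ≃ₜ A) (hf : STopologicallyStable f) : HasShadowing f := by
  intro ε hε
  obtain ⟨k, c, hc, hcs, hcd, H, h1, h2⟩ := key_shift f hf ε hε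
  have hδ : ∃ δ > 0, ∀ x y, dist x y ≤ δ → c x = c y := by
    have huc := CompactSpace.uniformContinuous_of_continuous
      ((continuous_of_discreteTopology (f := fun i : Fin k => (i.val : ℝ))).comp hc)
    rw [Metric.uniformContinuous_iff] at huc
    obtain ⟨δ, hδ, h⟩ := huc 1 one_pos
    refine ⟨δ / 2, by positivity, fun x y hxy => ?_⟩
    have h3 := h (show dist x y < δ by linarith)
    simp only [Function.comp_apply, Real.dist_eq] at h3
    have h4 : |((c x).val : ℤ) - ((c y).val : ℤ)| < 1 := by exact_mod_cast h3
    rw [Int.abs_lt_one_iff] at h4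
    exact Fin.ext (by omega)
  obtain ⟨δ, hδ, hcδ⟩ := hδ
  refine ⟨δ, hδ, fun x hx => ?_⟩
  have hpred : ∀ j, ∃ i, ∃ x, c x = i ∧ c (f x) = j := by
    intro j
    obtain ⟨x, rfl⟩ := hcs j
    exact ⟨c (f.symm x), f.symm x, rfl, by rw [Homeomorph.apply_symm_apply]⟩
  obtain ⟨w, hw⟩ := exists_path (R := fun i j => ∃ x, c x = i ∧ c (f x) = j)
    hpred (fun n => c (x n)) (fun n => ⟨x n, rfl, hcδ _ _ (hx n)⟩)
  · refine ⟨H (w, fun _ => true), fun i => ?_⟩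
    rw [key_iterate h1, dist_comm]
    apply h2
    rw [lab_iterate, hw]

theorem periodic_dense (f : A ≃ₜ A) (hf : STopologicallyStable f) (x : A)
    (hx : NonWandering f x) : x ∈ closure (Function.periodicPts (f : A → A)) := by
  rw [Metric.mem_closure_iff]
  intro ε hε
  obtain ⟨k, c, hc, hcs, hcd, H, h1, h2⟩ := key_shift f hf (ε / 2) (by positivity)
  obtain ⟨n, hn, y, hy, hny⟩ := hx {y | c y = c x}
    (((isOpen_discrete {c x}).preimage hc).mem_nhds rfl)
  obtain ⟨w, hw0, hw⟩ := exists_periodic_path (R := fun i j => ∃ x, c x = i ∧ c (f x) = j)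
    n hn (fun i => c (f^[i] y))
    (fun i => ⟨f^[i] y, rfl, by rw [Function.iterate_succ_apply']⟩)
    ((show c (f^[n] y) = c x from hny).trans (show c y = c x from hy).symm)
  refine ⟨H (w, fun _ => true), ⟨n, hn, ?_⟩, ?_⟩
  · unfold Function.IsPeriodicPt Function.IsFixedPt
    rw [key_iterate h1]
    congr 1
    refine Prod.ext (Subtype.ext (funext fun i => ?_)) (shift_iterate_snd _ _ _)
    rw [shift_iterate, hw]
  · rw [dist_comm]
    have := h2 (w, fun _ => true) x (by
      change _ = w.1 0
      rw [hw0]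
      exact (show c y = c x from hy).symm)
    linarith

end ShadowPeriodic

/-! ### North-south towers -/

section Tower

lemma continuous_ite_bool {Z : Type*} [TopologicalSpace Z] {a b c : Z → Bool}
    (ha : Continuous a) (hb : Continuous b) (hc : Continuous c) :
    Continuous fun z => if a z then b z else c z :=
  (continuous_of_discreteTopology
    (f := fun p : Bool × Bool × Bool => if p.1 then p.2.1 else p.2.2)).comp
    (ha.prodMk (hb.prodMk hc))

/-- A homeomorphism of the Cantor space with north-south dynamics. -/
def ns (s : ℕ → Bool) (n : ℕ) : Bool :=
  if s 0 then (match n with | 0 => true | n + 1 => s n)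
  else if s 1 then (match n with | 0 => true | 1 => false | n + 2 => s (n + 2))
  else s (n + 1)

/-- The inverse of `ns`. -/
def nsInv (s : ℕ → Bool) (n : ℕ) : Bool :=
  if s 0 then
    if s 1 then s (n + 1)
    else (match n with | 0 => false | 1 => true | n + 2 => s (n + 2))
  else (match n with | 0 => false | n + 1 => s n)

lemma nsInv_ns (s : ℕ → Bool) : nsInv (ns s) = s := by
  funext n
  cases h0 : s 0 <;> cases h1 : s 1 <;> rcases n with _ | _ | n <;> simp [nsInv, ns, h0, h1]

lemma ns_nsInv (s : ℕ → Bool) : ns (nsInv s) = s := by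
  funext n
  cases h0 : s 0 <;> cases h1 : s 1 <;> rcases n with _ | _ | n <;> simp [nsInv, ns, h0, h1]

lemma continuous_ns : Continuous ns := by
  refine continuous_pi fun n => ?_
  unfold ns
  refine continuous_ite_bool (continuous_apply 0) ?_
    (continuous_ite_bool (continuous_apply 1) ?_ (continuous_apply _))
  · rcases n with _ | n
    · exact continuous_const
    · exact continuous_apply n
  · rcases n with _ | _ | n
    · exact continuous_const
    · exact continuous_const
    · exact continuous_apply (n + 2)

lemma ns_true (s : ℕ → Bool) (h : s 0 = true) (n : ℕ) : ∀ i ≤ n, ns^[n] s i = true := by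
  induction n with
  | zero => intro i hi; obtain rfl : i = 0 := by omega
            exact h
  | succ n ih =>
    intro i hi
    rw [Function.iterate_succ_apply']
    have h0 := ih 0 (by omega)
    rcases i with _ | i
    · simp [ns, h0]
    · simp only [ns, h0, if_true]
      exact ih i (by omega)

lemma ns_tendsto_true (s : ℕ → Bool) (h : s 0 = true) :
    Tendsto (fun n => ns^[n] s) atTop (𝓝 fun _ => true) := by
  rw [tendsto_pi_nhds]
  intro i
  refine tendsto_const_nhds.congr' ?_
  filter_upwards [eventually_ge_atTop i] with n hn
  exact (ns_true s h n i hn).symm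

lemma ns_reach (k : ℕ) : ∀ s : ℕ → Bool, s k = true → ∃ m, ns^[m] s 0 = true := by
  induction k with
  | zero => intro s h; exact ⟨0, h⟩
  | succ k ih =>
    intro s h
    by_cases h0 : s 0 = true
    · exact ⟨0, h0⟩
    by_cases h1 : s 1 = true
    · refine ⟨1, ?_⟩
      simp [ns, h0, h1]
    obtain ⟨m, hm⟩ := ih (ns s) (by simp [ns, h0, h1, h])
    exact ⟨m + 1, hm⟩

lemma ns_tendsto (s : ℕ → Bool) :
    ∃ b : Bool, Tendsto (fun n => ns^[n] s) atTop (𝓝 fun _ => b) := by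
  by_cases h : ∃ k, s k = true
  · obtain ⟨k, hk⟩ := h
    obtain ⟨m, hm⟩ := ns_reach k s hk
    refine ⟨true, ?_⟩
    rw [← tendsto_add_atTop_iff_nat m]
    simp only [Function.iterate_add_apply]
    exact ns_tendsto_true _ hm
  · have hs : s = fun _ => false := by
      funext n
      by_contra h'
      exact h ⟨n, by simpa using h'⟩
    refine ⟨false, ?_⟩
    have hfix : ∀ n, ns^[n] s = s := by
      intro n
      apply Function.iterate_fixed
      rw [hs]
      funext n
      simp [ns]
    refine tendsto_const_nhds.congr fun n => ?_
    rw [hfix, hs]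

variable {E : Type} [TopologicalSpace E] [DiscreteTopology E] [Finite E] (n : ℕ)

/-- Tower of height `n + 1` over the north-south map. -/
def towerEquiv (E : Type) (n : ℕ) :
    ((E × Fin (n + 1)) × (ℕ → Bool)) ≃ ((E × Fin (n + 1)) × (ℕ → Bool)) where
  toFun y := ((y.1.1, y.1.2 + 1), if y.1.2 = Fin.last n then ns y.2 else y.2)
  invFun y := ((y.1.1, y.1.2 - 1), if y.1.2 = 0 then nsInv y.2 else y.2)
  left_inv := by
    rintro ⟨⟨e, r⟩, s⟩
    by_cases h : r = Fin.last n
    · have h2 : (-1 : Fin (n + 1)) = Fin.last n := by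
        rw [neg_eq_iff_add_eq_zero, add_comm (1 : Fin (n + 1)), Fin.last_add_one]
      simp [h, nsInv_ns, h2]
    · have h' : r + 1 ≠ 0 := by
        intro h'
        apply h
        rw [← Fin.last_add_one] at h'
        exact add_right_cancel h'
      simp [h, h']
  right_inv := by
    rintro ⟨⟨e, r⟩, s⟩
    by_cases h : r = 0
    · have h' : (0 : Fin (n + 1)) - 1 = Fin.last n := by
        rw [sub_eq_iff_eq_add, Fin.last_add_one]
      simp [h, h', ns_nsInv]
    · have h' : r - 1 ≠ Fin.last n := by
        intro h'
        rw [sub_eq_iff_eq_add, Fin.last_add_one] at h'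
        exact h h'
      simp [h, h']

/-- The tower as a homeomorphism. -/
def tower (E : Type) [TopologicalSpace E] [DiscreteTopology E] [Finite E] (n : ℕ) :
    ((E × Fin (n + 1)) × (ℕ → Bool)) ≃ₜ ((E × Fin (n + 1)) × (ℕ → Bool)) :=
  Continuous.homeoOfEquivCompactToT2 (f := towerEquiv E n) (by
    rw [continuous_prod_of_discrete_left]
    rintro ⟨e, r⟩
    change Continuous fun s : ℕ → Bool => ((e, r + 1), if r = Fin.last n then ns s else s)
    refine Continuous.prodMk continuous_const ?_
    by_cases h : r = Fin.last n
    · simp only [h, if_true]; exact continuous_ns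
    · simp only [h, if_false]; exact continuous_id)

lemma tower_apply (e : E) (r : Fin (n + 1)) (s : ℕ → Bool) :
    tower E n ((e, r), s) = ((e, r + 1), if r = Fin.last n then ns s else s) := rfl

lemma tower_climb (e : E) (s : ℕ → Bool) (i : ℕ) : ∀ r : Fin (n + 1), r.val + i = n →
    (tower E n)^[i + 1] ((e, r), s) = ((e, 0), ns s) := by
  induction i with
  | zero =>
    intro r hr
    obtain rfl : r = Fin.last n := Fin.ext (by simpa using hr)
    simp [tower_apply]
  | succ i ih =>
    intro r hr
    have hne : r ≠ Fin.last n := by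
      rintro rfl
      simp at hr
    rw [Function.iterate_succ_apply, tower_apply, if_neg hne]
    apply ih
    rw [Fin.val_add_one_of_lt (Fin.lt_last_iff_ne_last.mpr hne)]
    omega

lemma tower_return (e : E) (m : ℕ) : ∀ s : ℕ → Bool,
    ((tower E n)^[n + 1])^[m] ((e, 0), s) = ((e, 0), ns^[m] s) := by
  induction m with
  | zero => intro s; rfl
  | succ m ih =>
    intro s
    rw [Function.iterate_succ_apply, tower_climb n e s n 0 (by simp), ih]
    rfl

lemma tower_tendsto (y : (E × Fin (n + 1)) × (ℕ → Bool)) :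
    ∃ (e : E) (b : Bool) (φ : ℕ → ℕ),
      Tendsto (fun m => (tower E n)^[φ m] y) atTop (𝓝 ((e, 0), fun _ => b)) := by
  obtain ⟨⟨e, r⟩, s⟩ := y
  obtain ⟨b, hb⟩ := ns_tendsto (ns s)
  refine ⟨e, b, fun m => (n + 1) * m + ((n - r.val) + 1), ?_⟩
  have : ∀ m, (tower E n)^[(n + 1) * m + ((n - r.val) + 1)] ((e, r), s) =
      ((e, 0), ns^[m] (ns s)) := by
    intro m
    rw [Function.iterate_add_apply, tower_climb n e s _ r (by omega), Function.iterate_mul,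
      tower_return]
  simp only [this]
  exact tendsto_const_nhds.prodMk_nhds hb

end Tower

section Finite

lemma exists_idem {k : ℕ} (σ τ : Fin k → Fin k) :
    ∃ n : ℕ, σ^[n + 1 + (n + 1)] = σ^[n + 1] ∧ τ^[n + 1 + (n + 1)] = τ^[n + 1] := by
  obtain ⟨a, b, hab, h⟩ := Finite.exists_ne_map_eq_of_infinite
    (fun n : ℕ => ((σ^[n], τ^[n]) : (Fin k → Fin k) × (Fin k → Fin k)))
  wlog hlt : a < b generalizing a b
  · exact this b a hab.symm h.symm (by omega)
  obtain ⟨d, rfl⟩ := Nat.exists_eq_add_of_lt hlt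
  have gen : ∀ ρ : Fin k → Fin k, ρ^[a] = ρ^[a + d + 1] →
      ρ^[(d + 1) * (a + 1) + (d + 1) * (a + 1)] = ρ^[(d + 1) * (a + 1)] := by
    intro ρ hρ
    have h1 : ∀ q t, ρ^[a + t + (d + 1) * q] = ρ^[a + t] := by
      intro q t
      induction q with
      | zero => rfl
      | succ q ih =>
        rw [← ih, show a + t + (d + 1) * (q + 1) = (t + (d + 1) * q) + (a + d + 1) by ring,
          Function.iterate_add, ← hρ, ← Function.iterate_add]
        congr 1
        ring
    have h2 := h1 (a + 1) ((d + 1) * (a + 1) - a)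
    have h3 : a ≤ (d + 1) * (a + 1) := by nlinarith
    rwa [Nat.add_sub_cancel' h3] at h2
  refine ⟨(d + 1) * (a + 1) - 1, ?_⟩
  have h4 : (d + 1) * (a + 1) - 1 + 1 = (d + 1) * (a + 1) :=
    Nat.sub_add_cancel (by nlinarith)
  rw [h4]
  exact ⟨gen σ (congrArg Prod.fst h), gen τ (congrArg Prod.snd h)⟩

/-- Labels on the tower. -/
def tlab {k : ℕ} (R : Fin k → Fin k → Prop) (σ τ : Fin k → Fin k) (n : ℕ)
    (y : ({p : Fin k × Fin k // R p.1 p.2} × Fin (n + 1)) × (ℕ → Bool)) : Fin k :=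
  if y.2 0 then
    if y.2 1 then σ^[n + 1 + y.1.2] y.1.1.1.2 else σ^[y.1.2] y.1.1.1.2
  else
    if y.2 1 then τ^[n - y.1.2] y.1.1.1.1 else τ^[n + 1 + (n - y.1.2)] y.1.1.1.1

lemma continuous_tlab {k : ℕ} (R : Fin k → Fin k → Prop) (σ τ : Fin k → Fin k) (n : ℕ) :
    Continuous (tlab R σ τ n) := by
  rw [continuous_prod_of_discrete_left]
  rintro ⟨e, r⟩
  exact (continuous_of_discreteTopology (f := fun p : Bool × Bool =>
    if p.1 then if p.2 then σ^[n + 1 + r] e.1.2 else σ^[r] e.1.2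
    else if p.2 then τ^[n - r] e.1.1 else τ^[n + 1 + (n - r)] e.1.1)).comp
    (show Continuous fun s : ℕ → Bool => (s 0, s 1) from
      (continuous_apply 0).prodMk (continuous_apply 1))

lemma tlab_edge {k : ℕ} (R : Fin k → Fin k → Prop) (σ τ : Fin k → Fin k) (n : ℕ)
    (hσ : ∀ i, R i (σ i)) (hτ : ∀ i, R (τ i) i)
    (hσn : σ^[n + 1 + (n + 1)] = σ^[n + 1]) (hτn : τ^[n + 1 + (n + 1)] = τ^[n + 1])
    (y : ({p : Fin k × Fin k // R p.1 p.2} × Fin (n + 1)) × (ℕ → Bool)) :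
    R (tlab R σ τ n y) (tlab R σ τ n (tower _ n y)) := by
  have sσ : ∀ m x, R (σ^[m] x) (σ^[m + 1] x) := fun m x => by
    rw [Function.iterate_succ_apply']; exact hσ _
  have sτ : ∀ m x, R (τ^[m + 1] x) (τ^[m] x) := fun m x => by
    rw [Function.iterate_succ_apply']; exact hτ _
  obtain ⟨⟨⟨⟨a, b⟩, hab⟩, r⟩, s⟩ := y
  rw [tower_apply]
  by_cases hr : r = Fin.last n
  · subst hr
    rw [Fin.last_add_one, if_pos rfl]
    cases h0 : s 0 <;> cases h1 : s 1
    · cases h2 : s 2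
      · simp only [tlab, ns, h0, h1, h2]
        have := sτ (n + 1 + n) a
        rw [show n + 1 + n + 1 = n + 1 + (n + 1) by ring, hτn] at this
        simpa using this
      · simp only [tlab, ns, h0, h1, h2]
        simpa using sτ n a
    · simpa [tlab, ns, h0, h1] using hab
    · simpa [tlab, ns, h0, h1] using sσ n b
    · have := sσ (n + 1 + n) b
      rw [show n + 1 + n + 1 = n + 1 + (n + 1) by ring, hσn] at this
      simpa [tlab, ns, h0, h1] using this
  · rw [if_neg hr]
    have hlt := Fin.lt_last_iff_ne_last.mpr hr
    have hv : (r + 1).val = r.val + 1 := Fin.val_add_one_of_lt hlt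
    have hlt' : r.val < n := hlt
    obtain ⟨m, hm⟩ : ∃ m, n - r.val = m + 1 := ⟨n - r.val - 1, by omega⟩
    have hm' : n - (r.val + 1) = m := by omega
    cases h0 : s 0 <;> cases h1 : s 1 <;> simp only [tlab, h0, h1, hv, hm, hm'] <;> simp
    · exact sτ (n + 1 + m) a
    · exact sτ m a
    · exact sσ r.val b
    · exact sσ (n + 1 + r.val) b

variable {A : Type*} [MetricSpace A] [CompactSpace A] [PerfectSpace A]
  [TotallyDisconnectedSpace A] [Nonempty A]

theorem finite_periodic (f : A ≃ₜ A) (hf : STopologicallyStable f) :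
    (Function.periodicPts (f : A → A)).Finite := by
  obtain ⟨k, c, hc, hcs, -, hk⟩ := key f hf 1 one_pos
  let R : Fin k → Fin k → Prop := fun i j => ∃ x, c x = i ∧ c (f x) = j
  have hsucc : ∀ i, ∃ j, R i j := by
    intro i
    obtain ⟨x, rfl⟩ := hcs i
    exact ⟨_, x, rfl, rfl⟩
  have hpred : ∀ j, ∃ i, R i j := by
    intro j
    obtain ⟨x, rfl⟩ := hcs j
    exact ⟨c (f.symm x), f.symm x, rfl, by rw [Homeomorph.apply_symm_apply]⟩
  choose σ hσ using hsucc
  choose τ hτ using hpred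
  obtain ⟨n, hσn, hτn⟩ := exists_idem σ τ
  obtain ⟨H, hHc, hHs, hHG, -⟩ := hk _ (tower {p : Fin k × Fin k // R p.1 p.2} n)
    (tlab R σ τ n) (continuous_tlab R σ τ n) (by
      intro i j
      constructor
      · rintro ⟨y, rfl, rfl⟩
        exact tlab_edge R σ τ n hσ hτ hσn hτn y
      · intro hij
        refine ⟨((⟨(i, j), hij⟩, Fin.last n), fun m => decide (m = 1)), ?_, ?_⟩
        · simp [tlab]
        · rw [tower_apply, Fin.last_add_one, if_pos rfl]
          simp [tlab, ns])
  have orbit_fin : ∀ q ∈ Function.periodicPts (f : A → A),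
      (range fun m => (f : A → A)^[m] q).Finite := by
    intro q hq
    refine ((Set.finite_Iio (Function.minimalPeriod f q)).image
      fun m => (f : A → A)^[m] q).subset ?_
    rintro _ ⟨m, rfl⟩
    exact ⟨m % Function.minimalPeriod f q,
      Nat.mod_lt _ (Function.minimalPeriod_pos_of_mem_periodicPts hq),
      Function.iterate_mod_minimalPeriod_eq⟩
  let Z : {p : Fin k × Fin k // R p.1 p.2} × Bool → A := fun z => H ((z.1, 0), fun _ => z.2)
  have hfin : (⋃ z ∈ {z | Z z ∈ Function.periodicPts (f : A → A)},
      range fun m => (f : A → A)^[m] (Z z)).Finite :=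
    (Set.toFinite _).biUnion fun z hz => orbit_fin _ hz
  refine hfin.subset fun p hp => ?_
  obtain ⟨y, rfl⟩ := hHs p
  obtain ⟨e, b, φ, hφ⟩ := tower_tendsto n y
  have h1 : Tendsto (fun m => H ((tower _ n)^[φ m] y)) atTop (𝓝 (Z (e, b))) :=
    (hHc.tendsto _).comp hφ
  have h2 : Z (e, b) ∈ range fun m => (f : A → A)^[m] (H y) := by
    refine (orbit_fin _ hp).isClosed.mem_of_tendsto h1 (Eventually.of_forall fun m => ?_)
    exact ⟨φ m, key_iterate hHG _ _⟩
  obtain ⟨i, hi⟩ := h2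
  simp only at hi
  obtain ⟨m, hm, hper⟩ := hp
  have hper' : (f : A → A)^[m] (H y) = H y := hper
  simp only [mem_iUnion, mem_ofPred_eq, exists_prop]
  refine ⟨(e, b), ⟨m, hm, ?_⟩, (m - 1) * i, ?_⟩
  · rw [← hi]
    exact hper.apply_iterate i
  · simp only
    rw [← hi, ← Function.iterate_add_apply]
    have : (m - 1) * i + i = m * i := by
      obtain ⟨m, rfl⟩ : ∃ m', m = m' + 1 := ⟨m - 1, by omega⟩
      simp; ring
    rw [this, Function.iterate_mul]
    exact Function.iterate_fixed hper' i

end Finite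

end CantorAux

/-- On a Cantor space, a homeomorphism which is topologically stable in
the strong sense has the shadowing property and a finite non-wandering set. -/
theorem shadowing_and_finite_nonwandering_of_sTopologicallyStable
    {X : Type*} [MetricSpace X] [CompactSpace X] [PerfectSpace X]
    [TotallyDisconnectedSpace X] [Nonempty X] (f : X ≃ₜ X)
    (hf : STopologicallyStable f) :
    HasShadowing f ∧ {x : X | NonWandering f x}.Finite := by
  refine ⟨CantorAux.hasShadowing f hf, ?_⟩
  have hfin := CantorAux.finite_periodic f hf
  refine hfin.subset fun x hx => ?_
  have := CantorAux.periodic_dense f hf x hx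
  rwa [hfin.isClosed.closure_eq] at this
end

section
/- Let (X,d) be a Cantor space. Then the set of homeomorphisms of X that are NOT topologically stable is residual (contains a dense Gδ set) in the space of homeomorphisms of X equipped with the metric D. -/
/-! Common definitions: distances on maps/homeomorphisms of a metric space,
topological stability and shadowing-type properties. -/

variable {X : Type*} [MetricSpace X]

open Set Filter Topology

namespace CantorStab

section Brouwer
variable {C : Type*} [MetricSpace C] [CompactSpace C] [PerfectSpace C]
    [TotallyDisconnectedSpace C]

/-- one open nonempty set can be split by a Boolean locally constant function -/
lemma split_one (F : Set C) (hF : IsOpen F) (A : Set C) (hA : IsClopen A) :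
    ∃ b : LocallyConstant C Bool, (F.Nonempty → ∀ β, ∃ y ∈ F, b y = β) ∧
      (∀ x ∈ F, ∀ y ∈ F, x ∈ A → y ∉ A → b x ≠ b y) := by
  classical
  have key : ∀ S : Set C, IsClopen S → IsLocallyConstant (fun x => decide (x ∈ S)) := by
    intro S hS
    rw [IsLocallyConstant.iff_continuous]
    refine continuous_bool_rng true |>.2 ?_
    convert hS using 1
    ext x; simp
  by_cases h : (∃ x ∈ F, x ∈ A) ∧ (∃ y ∈ F, y ∉ A)
  · obtain ⟨⟨x, hx, hxA⟩, ⟨y, hy, hyA⟩⟩ := h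
    refine ⟨⟨_, key A hA⟩, fun _ β => ?_, fun u _ v _ huA hvA => by simp [huA, hvA]⟩
    cases β
    · exact ⟨y, hy, by simpa using hyA⟩
    · exact ⟨x, hx, by simpa using hxA⟩
  · by_cases hne : F.Nonempty
    · obtain ⟨x, hx⟩ := hne
      obtain ⟨y, hy, hyx⟩ : ∃ y ∈ F, y ≠ x := by
        have := (PerfectSpace.not_isolated x).nonempty_of_mem
          (s := F ∩ {x}ᶜ) (inter_mem (mem_nhdsWithin_of_mem_nhds (hF.mem_nhds hx))
            self_mem_nhdsWithin)
        obtain ⟨y, h1, h2⟩ := this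
        exact ⟨y, h1, h2⟩
      obtain ⟨S, hS, hyS, hxS⟩ := exists_isClopen_of_totally_separated hyx
      refine ⟨⟨_, key S hS⟩, fun _ β => ?_, fun u hu v hv huA hvA =>
        absurd ⟨⟨u, hu, huA⟩, ⟨v, hv, hvA⟩⟩ h⟩
      cases β
      · exact ⟨x, hx, by simpa using hxS⟩
      · exact ⟨y, hy, by simpa using hyS⟩
    · exact ⟨LocallyConstant.const C true, fun h' => absurd h' hne,
        fun x hx => absurd ⟨x, hx⟩ hne⟩

lemma split_all (c : LocallyConstant C (List Bool)) (A : TopologicalSpace.Clopens C) :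
    ∃ b : LocallyConstant C Bool, (∀ x, ∀ β, ∃ y, c y = c x ∧ b y = β) ∧
      (∀ x y, c x = c y → x ∈ A → y ∉ A → b x ≠ b y) := by
  choose b hb1 hb2 using fun t : List Bool =>
    split_one {x | c x = t} (c.isLocallyConstant.isOpen_fiber t) (A : Set C) A.isClopen
  refine ⟨⟨fun x => b (c x) x, ?_⟩, ?_, ?_⟩
  · rw [IsLocallyConstant.iff_eventually_eq]
    intro x
    filter_upwards [c.isLocallyConstant.eventually_eq x,
      (b (c x)).isLocallyConstant.eventually_eq x] with y h1 h2
    have h1' : c y = c x := h1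
    have h2' : b (c x) y = b (c x) x := h2
    rw [h1', h2']
  · intro x β
    obtain ⟨y, hy, hyb⟩ := hb1 (c x) ⟨x, rfl⟩ β
    refine ⟨y, hy, ?_⟩
    have hy' : c y = c x := hy
    simp only [LocallyConstant.coe_mk, hy', hyb]
  · intro x y hxy hx hy
    have := hb2 (c y) x hxy y rfl hx hy
    simpa only [LocallyConstant.coe_mk, hxy] using this

/-- Brouwer's characterisation. -/
theorem brouwer [Nonempty C] : Nonempty (C ≃ₜ (ℕ → Bool)) := by
  classical
  have hcount : Countable (TopologicalSpace.Clopens C) :=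
    TopologicalSpace.Clopens.countable_iff_secondCountable.2 inferInstance
  obtain ⟨A, hA⟩ := exists_surjective_nat (TopologicalSpace.Clopens C)
  choose b hb1 hb2 using fun (c : LocallyConstant C (List Bool)) (n : ℕ) => split_all c (A n)
  let s : ℕ → LocallyConstant C (List Bool) := fun n => Nat.rec (LocallyConstant.const C [])
    (fun n c => ⟨fun x => b c n x :: c x,
      IsLocallyConstant.comp₂ (b c n).isLocallyConstant c.isLocallyConstant (fun u v => u :: v)⟩) n
  have hs : ∀ n x, s (n+1) x = b (s n) n x :: s n x := fun n x => rfl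
  let e : C → ℕ → Bool := fun x n => b (s n) n x
  have hse : ∀ n x y, s n x = s n y ↔ ∀ k < n, e x k = e y k := by
    intro n x y
    induction n with
    | zero => simp [s]
    | succ n ih =>
      rw [hs, hs, List.cons_eq_cons, ih]
      constructor
      · rintro ⟨h1, h2⟩ k hk
        rcases Nat.lt_succ_iff_lt_or_eq.1 hk with h | rfl
        · exact h2 k h
        · exact h1
      · intro h
        exact ⟨h n (Nat.lt_succ_self n), fun k hk => h k (by omega)⟩
  have hcont : Continuous e := continuous_pi fun n => (b (s n) n).continuous
  have hinj : Function.Injective e := by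
    intro x y hxy
    by_contra hne
    obtain ⟨S, hS, hxS, hyS⟩ := exists_isClopen_of_totally_separated hne
    obtain ⟨n, hn⟩ := hA ⟨S, hS⟩
    refine hb2 (s n) n x y ((hse n x y).2 fun k _ => congrFun hxy k) ?_ ?_ (congrFun hxy n)
    · rw [hn]; exact hxS
    · rw [hn]; exact hyS
  have hpre : ∀ (z : ℕ → Bool) (n : ℕ), ∃ x, ∀ k < n, e x k = z k := by
    intro z n
    induction n with
    | zero => exact ⟨Classical.arbitrary C, by simp⟩
    | succ n ih =>
      obtain ⟨x, hx⟩ := ih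
      obtain ⟨y, hy1, hy2⟩ := hb1 (s n) n x (z n)
      refine ⟨y, fun k hk => ?_⟩
      rcases Nat.lt_succ_iff_lt_or_eq.1 hk with h | rfl
      · rw [(hse n y x).1 hy1 k h, hx k h]
      · exact hy2
  have hsurj : Function.Surjective e := by
    intro z
    choose x hx using hpre z
    have hcl : IsClosed (range e) := (isCompact_range hcont).isClosed
    have : Tendsto (fun n => e (x n)) atTop (𝓝 z) := by
      rw [tendsto_pi_nhds]
      intro k
      refine tendsto_const_nhds.congr' ?_
      filter_upwards [eventually_gt_atTop k] with n hn
      exact (hx n k hn).symm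
    exact hcl.mem_of_tendsto this (Eventually.of_forall fun n => ⟨x n, rfl⟩)
  exact ⟨hcont.homeoOfEquivCompactToT2 (f := Equiv.ofBijective e ⟨hinj, hsurj⟩)⟩

end Brouwer

instance : PerfectSpace ℤ_[2] := by
  rw [perfectSpace_iff_forall_not_isolated]
  intro x
  rw [← mem_closure_iff_nhdsWithin_neBot]
  refine mem_closure_of_tendsto (f := fun n : ℕ => x + (2:ℤ_[2])^n) (b := atTop) ?_ ?_
  · have h : Tendsto (fun n : ℕ => (2:ℤ_[2])^n) atTop (𝓝 0) := by
      apply tendsto_pow_atTop_nhds_zero_of_norm_lt_one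
      have := PadicInt.norm_p (p := 2)
      norm_num at this
      rw [this]; norm_num
    simpa using h.const_add x
  · refine Eventually.of_forall fun n => ?_
    simp

/-- an aperiodic homeomorphism of the Cantor space -/
lemma exists_aperiodic : ∃ α : (ℕ → Bool) ≃ₜ (ℕ → Bool), ∀ n x, (α : _ → _)^[n+1] x ≠ x := by
  obtain ⟨e⟩ := brouwer (C := ℤ_[2])
  refine ⟨(e.symm.trans (Homeomorph.addRight 1)).trans e, fun n x hx => ?_⟩
  have : ∀ m, e.symm (((e.symm.trans (Homeomorph.addRight (1 : ℤ_[2]))).trans e : _ → _)^[m] x)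
      = e.symm x + m := by
    intro m
    induction m with
    | zero => simp
    | succ m ih =>
      rw [Function.iterate_succ_apply']
      simp [ih, add_assoc]
  have h := this (n+1)
  rw [hx] at h
  have h2 : ((n+1 : ℕ) : ℤ_[2]) = 0 := by simpa using h.symm
  exact absurd (Nat.cast_eq_zero.1 h2) (by omega)

/-- splitting coordinates, fixing the first `n` ones -/
lemma exists_split (n : ℕ) : ∃ ψ : (ℕ → Bool) ≃ₜ (ℕ → Bool) × (ℕ → Bool),
    ∀ u, ∀ k < n, (ψ u).1 k = u k := by
  refine ⟨⟨⟨fun u => (fun k => if k < n then u k else u (n + 2 * (k - n)),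
      fun k => u (n + 2 * k + 1)),
    fun p k => if k < n then p.1 k else if (k - n) % 2 = 0 then p.1 (n + (k - n) / 2)
      else p.2 ((k - n) / 2), ?_, ?_⟩, ?_, ?_⟩, ?_⟩
  · intro u
    funext k
    dsimp only
    split_ifs with h1 h2 h3
    · rfl
    · omega
    · congr 1; omega
    · congr 1; omega
  · rintro ⟨p, q⟩
    refine Prod.ext ?_ ?_
    · funext k
      dsimp only
      split_ifs with h1 h2 h3
      · rfl
      · omega
      · congr 1; omega
      · omega
    · funext k
      dsimp only
      rw [if_neg (by omega), if_neg (by omega)]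
      congr 1; omega
  · refine Continuous.prodMk (continuous_pi fun k => ?_) (continuous_pi fun k => ?_)
    · split_ifs <;> fun_prop
    · fun_prop
  · refine continuous_pi fun k => ?_
    dsimp only; split_ifs <;> fun_prop
  · intro u k hk
    simp [hk]

/-- swapping two points in the same cylinder, fixing everything else outside the cylinder -/
lemma exists_swap (n : ℕ) (a b : ℕ → Bool) (hab : ∀ k < n, a k = b k) :
    ∃ φ : (ℕ → Bool) ≃ₜ (ℕ → Bool), (∀ u, ∀ k < n, φ u k = u k) ∧
      (∀ u, ∀ k < n, φ.symm u k = u k) ∧ φ b = a ∧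
      ∀ u, ¬ (∀ k < n, u k = a k) → φ u = u := by
  classical
  let F : (ℕ → Bool) → (ℕ → Bool) := fun u =>
    if ∀ k < n, u k = a k then fun k => xor (u k) (xor (a k) (b k)) else u
  have hfix : ∀ u, ∀ k < n, F u k = u k := by
    intro u k hk
    simp only [F]
    split_ifs with h
    · simp [hab k hk]
    · rfl
  have hinv : ∀ u, F (F u) = u := by
    intro u
    by_cases h : ∀ k < n, u k = a k
    · have h' : ∀ k < n, F u k = a k := fun k hk => (hfix u k hk).trans (h k hk)
      have e1 : F (F u) = fun k => xor (F u k) (xor (a k) (b k)) := if_pos h'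
      have e2 : F u = fun k => xor (u k) (xor (a k) (b k)) := if_pos h
      rw [e1, e2]
      funext k
      dsimp only
      cases u k <;> cases a k <;> cases b k <;> rfl
    · have e2 : F u = u := if_neg h
      rw [e2, e2]
  have hclopen : IsClopen {u : ℕ → Bool | ∀ k < n, u k = a k} := by
    have : {u : ℕ → Bool | ∀ k < n, u k = a k} = ⋂ k ∈ Finset.range n, {u | u k = a k} := by
      ext u; simp
    rw [this]
    refine isClopen_biInter_finset fun k _ => ?_
    exact (isClopen_discrete {a k}).preimage (continuous_apply k)
  have hcont : Continuous F := by
    refine Continuous.if ?_ ?_ continuous_id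
    · intro u hu
      rw [hclopen.frontier_eq] at hu
      exact absurd hu (by simp)
    · refine continuous_pi fun k => ?_
      exact (continuous_of_discreteTopology (f := fun t : Bool => xor t (xor (a k) (b k)))).comp
        (continuous_apply k)
  refine ⟨⟨⟨F, F, hinv, hinv⟩, hcont, hcont⟩, hfix, hfix, ?_, fun u hu => if_neg hu⟩
  have : F b = fun k => xor (b k) (xor (a k) (b k)) := if_pos fun k hk => (hab k hk).symm
  change F b = a
  rw [this]
  funext k
  cases a k <;> cases b k <;> rfl

section Main
variable {Y : Type*} [MetricSpace Y] [CompactSpace Y]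

lemma dist_le_dC0 (f g : Y → Y) (x : Y) : dist (f x) (g x) ≤ dC0 f g := by
  refine le_ciSup (f := fun x => dist (f x) (g x)) ⟨Metric.diam (univ : Set Y), ?_⟩ x
  rintro _ ⟨y, rfl⟩
  exact Metric.dist_le_diam_of_mem isCompact_univ.isBounded (mem_univ _) (mem_univ _)

lemma dist_le_DH (f g : Y ≃ₜ Y) (x : Y) : dist (f x) (g x) ≤ DH f g :=
  (dist_le_dC0 _ _ x).trans (le_max_left _ _)

lemma DH_lt [Nonempty Y] {f g : Y ≃ₜ Y} {ε : ℝ} (hε : 0 < ε) (h1 : ∀ x, dist (f x) (g x) < ε / 2)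
    (h2 : ∀ x, dist (f.symm x) (g.symm x) < ε / 2) : DH f g < ε := by
  refine max_lt ?_ ?_
  · exact (ciSup_le fun x => (h1 x).le).trans_lt (half_lt_self hε)
  · exact (ciSup_le fun x => (h2 x).le).trans_lt (half_lt_self hε)

lemma unif (f : Y ≃ₜ Y) {ε : ℝ} (hε : 0 < ε) :
    ∃ δ > 0, ∀ x y, dist x y < δ → dist (f x) (f y) < ε := by
  obtain ⟨δ, h, h'⟩ := Metric.uniformContinuous_iff.1
    (CompactSpace.uniformContinuous_of_continuous f.continuous) ε hε
  exact ⟨δ, h, fun x y hxy => h' hxy⟩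

lemma iter_close (f : Y ≃ₜ Y) (m : ℕ) : ∀ η > 0, ∃ δ > 0, ∀ g : Y ≃ₜ Y, DH f g < δ →
    ∀ x, dist ((f : Y → Y)^[m] x) ((g : Y → Y)^[m] x) < η := by
  induction m with
  | zero => exact fun η hη => ⟨1, one_pos, fun g _ x => by simpa using hη⟩
  | succ m ih =>
    intro η hη
    obtain ⟨δ₁, h1, hf⟩ := unif f (half_pos hη)
    obtain ⟨δ₂, h2, hg⟩ := ih δ₁ h1
    refine ⟨min δ₂ (η / 2), lt_min h2 (half_pos hη), fun g hD x => ?_⟩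
    rw [Function.iterate_succ_apply', Function.iterate_succ_apply']
    have a1 := hf _ _ (hg g (hD.trans_le (min_le_left _ _)) x)
    have a2 := (dist_le_DH f g ((g : Y → Y)^[m] x)).trans_lt (hD.trans_le (min_le_right _ _))
    linarith [dist_triangle (f ((f : Y → Y)^[m] x)) (f ((g : Y → Y)^[m] x))
      (g ((g : Y → Y)^[m] x))]

lemma open_aper [Nonempty Y] (m : ℕ) (f : Y ≃ₜ Y) (hf : ∀ x, (f : Y → Y)^[m] x ≠ x) :
    ∃ ε > 0, ∀ g : Y ≃ₜ Y, DH f g < ε → ∀ x, (g : Y → Y)^[m] x ≠ x := by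
  have hc : Continuous fun x => dist ((f : Y → Y)^[m] x) x :=
    (f.continuous.iterate m).dist continuous_id
  obtain ⟨x₀, -, hx₀⟩ := isCompact_univ.exists_isMinOn univ_nonempty hc.continuousOn
  obtain ⟨δ, hδ, h⟩ := iter_close f m _ (dist_pos.2 (hf x₀))
  refine ⟨δ, hδ, fun g hg x hx => ?_⟩
  have h1 := h g hg x
  rw [hx] at h1
  exact absurd (hx₀ (mem_univ x)) (not_le.2 h1)

lemma cyl (e : Y ≃ₜ (ℕ → Bool)) {ε : ℝ} (hε : 0 < ε) :
    ∃ n, ∀ x y, (∀ k < n, e x k = e y k) → dist x y < ε := by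
  by_contra hcon
  push Not at hcon
  choose x y hxy hd using hcon
  obtain ⟨p, φ, hφ, hp⟩ := CompactSpace.tendsto_subseq (fun n => (x n, y n))
  have hp1 : Tendsto (fun n => x (φ n)) atTop (𝓝 p.1) := (continuous_fst.tendsto p).comp hp
  have hp2 : Tendsto (fun n => y (φ n)) atTop (𝓝 p.2) := (continuous_snd.tendsto p).comp hp
  have heq : p.1 = p.2 := by
    apply e.injective
    funext k
    have t1 := ((continuous_apply k).comp e.continuous).tendsto p.1 |>.comp hp1
    have t2 := ((continuous_apply k).comp e.continuous).tendsto p.2 |>.comp hp2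
    refine tendsto_nhds_unique t1 (t2.congr' ?_)
    filter_upwards [eventually_gt_atTop k] with n hn
    exact (hxy (φ n) k (hn.trans_le hφ.le_apply)).symm
  have : Tendsto (fun n => dist (x (φ n)) (y (φ n))) atTop (𝓝 0) := by
    have := hp1.dist hp2
    rwa [heq, dist_self] at this
  exact absurd (ge_of_tendsto' this fun n => hd (φ n)) (not_le.2 hε)

lemma dense_aper [Nonempty Y] (e : Y ≃ₜ (ℕ → Bool)) (f : Y ≃ₜ Y) {ε : ℝ} (hε : 0 < ε) :
    ∃ g : Y ≃ₜ Y, (∀ n x, (g : Y → Y)^[n+1] x ≠ x) ∧ DH f g < ε := by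
  obtain ⟨α, hα⟩ := exists_aperiodic
  have hε4 : 0 < ε / 4 := by positivity
  obtain ⟨δ₁, h1, hf1⟩ := unif f hε4
  obtain ⟨δ₂, h2, hf2⟩ := unif f.symm hε4
  obtain ⟨n, hn⟩ := cyl e (lt_min hε4 (lt_min h1 h2))
  obtain ⟨ψ, hψ⟩ := exists_split n
  let Ψ : Y ≃ₜ Y × (ℕ → Bool) :=
    (e.trans ψ).trans (e.symm.prodCongr (Homeomorph.refl _))
  have hΨ : ∀ x, dist (Ψ x).1 x < min (ε / 4) (min δ₁ δ₂) := by
    intro x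
    apply hn
    intro k hk
    have : e (Ψ x).1 = (ψ (e x)).1 := by simp [Ψ]
    rw [this, hψ _ _ hk]
  let g : Y ≃ₜ Y := (Ψ.trans (f.prodCongr α)).trans Ψ.symm
  have hg : ∀ x, Ψ (g x) = (f (Ψ x).1, α (Ψ x).2) := by intro x; simp [g, Prod.map]
  have hg' : ∀ x, Ψ (g.symm x) = (f.symm (Ψ x).1, α.symm (Ψ x).2) := by intro x; simp [g, Prod.map]
  refine ⟨g, fun m x hx => ?_, DH_lt hε (fun x => ?_) fun x => ?_⟩
  · have : ∀ m, (Ψ ((g : Y → Y)^[m] x)).2 = (α : _ → _)^[m] (Ψ x).2 := by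
      intro m
      induction m with
      | zero => rfl
      | succ m ih => rw [Function.iterate_succ_apply', Function.iterate_succ_apply', hg, ih]
    have h := this (m+1)
    rw [hx] at h
    exact hα m _ h.symm
  · have a1 := (hΨ (g x)).trans_le (min_le_left _ _)
    have a2 := hf1 _ _ ((hΨ x).trans_le ((min_le_right _ _).trans (min_le_left _ _)))
    rw [hg] at a1
    rw [dist_comm] at a2
    linarith [dist_triangle (f x) (f (Ψ x).1) (g x)]
  · have a1 := (hΨ (g.symm x)).trans_le (min_le_left _ _)
    have a2 := hf2 _ _ ((hΨ x).trans_le ((min_le_right _ _).trans (min_le_right _ _)))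
    rw [hg'] at a1
    rw [dist_comm] at a2
    linarith [dist_triangle (f.symm x) (f.symm (Ψ x).1) (g.symm x)]

lemma dense_per [Nonempty Y] (e : Y ≃ₜ (ℕ → Bool)) (f : Y ≃ₜ Y) {ε : ℝ} (hε : 0 < ε) :
    ∃ g : Y ≃ₜ Y, (∃ n x, (g : Y → Y)^[n+1] x = x) ∧ DH f g < ε := by
  classical
  have hε2 : 0 < ε / 2 := by positivity
  obtain ⟨δ₂, h2, hf2⟩ := unif f.symm hε2
  obtain ⟨n, hn⟩ := cyl e (lt_min hε2 h2)
  let x₀ : Y := Classical.arbitrary Y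
  have hex : ∃ m, ∃ y : Y, ∀ k < n, e y k = e ((f : Y → Y)^[m+1] y) k := by
    obtain ⟨i, j, hij, h⟩ := Finite.exists_ne_map_eq_of_infinite
      (fun i : ℕ => fun k : Fin n => e ((f : Y → Y)^[i] x₀) k)
    have key : ∀ i j : ℕ, i < j → (fun k : Fin n => e ((f : Y → Y)^[i] x₀) k) =
        (fun k : Fin n => e ((f : Y → Y)^[j] x₀) k) →
        ∃ m, ∃ y : Y, ∀ k < n, e y k = e ((f : Y → Y)^[m+1] y) k := by
      intro i j hij h
      refine ⟨j - i - 1, (f : Y → Y)^[i] x₀, fun k hk => ?_⟩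
      rw [← Function.iterate_add_apply, show j - i - 1 + 1 + i = j by omega]
      exact congrFun h ⟨k, hk⟩
    rcases lt_or_gt_of_ne hij with h' | h'
    · exact key i j h' h
    · exact key j i h' h.symm
  obtain ⟨y, hy⟩ := Nat.find_spec hex
  have hmin := fun m => Nat.find_min hex (m := m)
  set m := Nat.find hex
  obtain ⟨φ, hφ1, hφ2, hφ3, hφ4⟩ := exists_swap n (e y) (e ((f : Y → Y)^[m+1] y)) hy
  let Φ : Y ≃ₜ Y := (e.trans φ).trans e.symm
  have hΦ1 : ∀ x, dist x (Φ x) < min (ε / 2) δ₂ := by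
    intro x
    apply hn
    intro k hk
    simp [Φ, hφ1 _ k hk]
  have hΦ2 : ∀ x, dist x (Φ.symm x) < min (ε / 2) δ₂ := by
    intro x
    apply hn
    intro k hk
    simp [Φ, hφ2 _ k hk]
  refine ⟨f.trans Φ, ⟨m, y, ?_⟩, DH_lt hε (fun x => ?_) fun x => ?_⟩
  · have : ∀ j ≤ m, ((f.trans Φ : Y ≃ₜ Y) : Y → Y)^[j] y = (f : Y → Y)^[j] y := by
      intro j hj
      induction j with
      | zero => rfl
      | succ j ih =>
        rw [Function.iterate_succ_apply', ih (by omega)]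
        have : φ (e ((f : Y → Y)^[j+1] y)) = e ((f : Y → Y)^[j+1] y) := by
          apply hφ4
          intro hcon
          exact hmin j (by omega) ⟨y, fun k hk => (hcon k hk).symm⟩
        rw [Function.iterate_succ_apply'] at this ⊢
        simp [Φ, this]
    rw [Function.iterate_succ_apply', this m le_rfl]
    rw [Function.iterate_succ_apply'] at hφ3
    simp [Φ, hφ3]
  · exact (hΦ1 (f x)).trans_le (min_le_left _ _)
  · exact hf2 _ _ ((hΦ2 x).trans_le (min_le_right _ _))

end Main

end CantorStab

/-- On a Cantor space, the set of homeomorphisms that are NOT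
topologically stable is residual with respect to the metric `D`: it contains a
`D`-dense `D`-Gδ set (a countable intersection of `D`-open sets). -/
theorem not_topologicallyStable_residual
    (X : Type*) [MetricSpace X] [CompactSpace X] [PerfectSpace X]
    [TotallyDisconnectedSpace X] [Nonempty X] :
    ∃ U : ℕ → Set (X ≃ₜ X),
      (∀ n, ∀ f ∈ U n, ∃ ε > 0, ∀ g : X ≃ₜ X, DH f g < ε → g ∈ U n) ∧
      (∀ f : X ≃ₜ X, ∀ ε > 0, ∃ g ∈ ⋂ n, U n, DH f g < ε) ∧
      (⋂ n, U n) ⊆ {f : X ≃ₜ X | ¬ TopologicallyStable f} := by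
  obtain ⟨e⟩ := CantorStab.brouwer (C := X)
  refine ⟨fun n => {f | ∀ x, (f : X → X)^[n+1] x ≠ x}, ?_, ?_, ?_⟩
  · intro n f hf
    exact CantorStab.open_aper (n+1) f hf
  · intro f ε hε
    obtain ⟨g, hg, hD⟩ := CantorStab.dense_aper e f hε
    exact ⟨g, Set.mem_iInter.2 fun n x => hg n x, hD⟩
  · intro f hf hst
    obtain ⟨δ, hδ, H⟩ := hst 1 one_pos
    obtain ⟨g, ⟨n, x, hx⟩, hD⟩ := CantorStab.dense_per e f hδ
    obtain ⟨h, -, -, hc⟩ := H g hD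
    have hsemi : Function.Semiconj h g f := fun z => congrFun hc z
    have := (hsemi.iterate_right (n+1)) x
    rw [hx] at this
    exact Set.mem_iInter.1 hf n (h x) this.symm
end
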